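/- Fix a real number p with 0 < p ≤ 1 and real numbers α₁ ≥ α₂ ≥ α₃ > 0. For every real δ > 0, the probability that the binomial random graph G(⌈(2α₁+α₂+α₃+δ)n⌉, p) arrows (C_{2⌊α₁n⌋}, C_{2⌊α₂n⌋}, C_{2⌊α₃n⌋}) tends to 1 as n → ∞. -/

import Mathlib

-- Probability, under the binomial random graph model `G(N,p)`, of a set of graphs
-- on the vertex set `Fin N`: each possible edge is present independently with probability `p`.
open Classical in
noncomputable def graphProbability (N : ℕ) (p : ℝ) (E : Set (SimpleGraph (Fin N))) : ℝ :=
  ∑ G : SimpleGraph (Fin N),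
    if G ∈ E then p ^ (Nat.card G.edgeSet) * (1 - p) ^ (N.choose 2 - Nat.card G.edgeSet) else 0

/-- `F` has a cycle of length `m`, all of whose edges get color `i` under `c`. -/
def HasMonoCycle {V : Type*} (F : SimpleGraph V) {k : ℕ} (c : F.edgeSet → Fin k)
    (i : Fin k) (m : ℕ) : Prop :=
  ∃ (v : V) (w : F.Walk v v), w.IsCycle ∧ w.length = m ∧
    ∀ e (h : e ∈ w.edges), c ⟨e, w.edges_subset_edgeSet h⟩ = i

/-- `F → (C_{n 0}, …, C_{n (k-1)})`: every `k`-coloring of the edges of `F` yields,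
for some color `i`, a cycle on `n i` vertices all of whose edges have color `i`. -/
def ArrowsCycles {V : Type*} (F : SimpleGraph V) {k : ℕ} (n : Fin k → ℕ) : Prop :=
  ∀ c : F.edgeSet → Fin k, ∃ i : Fin k, HasMonoCycle F c i (n i)

open Classical in
/-- The weight `t v` counted only on the class `x` of `c`. -/
noncomputable def classWeight {V ι : Type*} (c : V → ι) (t : V → ℕ) (x : ι) (v : V) : ℕ :=
  if c v = x then t v else 0

/-- Two points lie in the same class of `c` and their weights add up to at least `2`. -/
def Covers {V ι : Type*} (c : V → ι) (t : V → ℕ) (u v : V) : Prop :=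
  c u = c v ∧ 2 ≤ t u + t v

/-- Every point of `S` receives total weight at least `2` from one class of each colour
and one further class. -/
def FourClassCover {V ι : Type*} (c₁ c₂ c₃ : V → ι) (t₁ t₂ t₃ : V → ℕ) (S : Finset V) : Prop :=
  ∃ x₁ x₂ x₃ x,
    (∀ v ∈ S, 2 ≤ classWeight c₁ t₁ x₁ v + classWeight c₂ t₂ x₂ v + classWeight c₃ t₃ x₃ v +
      classWeight c₁ t₁ x v) ∨
    (∀ v ∈ S, 2 ≤ classWeight c₁ t₁ x₁ v + classWeight c₂ t₂ x₂ v + classWeight c₃ t₃ x₃ v +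
      classWeight c₂ t₂ x v) ∨
    (∀ v ∈ S, 2 ≤ classWeight c₁ t₁ x₁ v + classWeight c₂ t₂ x₂ v + classWeight c₃ t₃ x₃ v +
      classWeight c₃ t₃ x v)

lemma FourClassCover.swap₂₃ {V ι : Type*} {c₁ c₂ c₃ : V → ι} {t₁ t₂ t₃ : V → ℕ} {S : Finset V}
    (h : FourClassCover c₁ c₂ c₃ t₁ t₂ t₃ S) : FourClassCover c₁ c₃ c₂ t₁ t₃ t₂ S := by
  obtain ⟨x₁, x₂, x₃, x, h⟩ := h
  refine ⟨x₁, x₃, x₂, x, ?_⟩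
  rcases h with h | h | h
  · left; intro v hv; have := h v hv; omega
  · right; right; intro v hv; have := h v hv; omega
  · right; left; intro v hv; have := h v hv; omega

lemma FourClassCover.swap₁₂ {V ι : Type*} {c₁ c₂ c₃ : V → ι} {t₁ t₂ t₃ : V → ℕ} {S : Finset V}
    (h : FourClassCover c₁ c₂ c₃ t₁ t₂ t₃ S) : FourClassCover c₂ c₁ c₃ t₂ t₁ t₃ S := by
  obtain ⟨x₁, x₂, x₃, x, h⟩ := h
  refine ⟨x₂, x₁, x₃, x, ?_⟩
  rcases h with h | h | h
  · right; left; intro v hv; have := h v hv; omega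
  · left; intro v hv; have := h v hv; omega
  · right; right; intro v hv; have := h v hv; omega

lemma fourClassCover_of_spanning_aux {V ι : Type*} {c₁ c₂ c₃ : V → ι} {t₁ t₂ t₃ : V → ℕ}
    {S : Finset V}
    (H : ∀ u ∈ S, ∀ v ∈ S, Covers c₁ t₁ u v ∨ Covers c₂ t₂ u v ∨ Covers c₃ t₃ u v)
    {x y : ι} (hx : ∀ v ∈ S, c₁ v = x) (hy : ∀ v ∈ S, t₁ v = 0 → c₂ v = y) :
    FourClassCover c₁ c₂ c₃ t₁ t₂ t₃ S := by
  unfold Covers at H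
  by_cases h0 : ∀ v ∈ S, 1 ≤ t₁ v
  · refine ⟨x, y, y, x, Or.inl fun v hv => ?_⟩
    have := h0 v hv
    simp [classWeight, hx v hv]; omega
  push Not at h0
  by_cases hI : ∀ b ∈ S, t₁ b = 0 → 1 ≤ t₂ b
  · by_cases hI1 : ∀ d ∈ S, t₁ d ≤ 1 → c₂ d = y ∧ 1 ≤ t₂ d
    · refine ⟨x, y, y, y, Or.inr (Or.inl fun v hv => ?_)⟩
      have h1 := hI1 v hv
      have h2 := hx v hv
      simp only [classWeight]; grind
    push Not at hI1
    obtain ⟨d, hd, hd1, hd2⟩ := hI1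
    by_cases hI2 : ∀ b ∈ S, t₁ b = 0 → 2 ≤ t₂ b
    · refine ⟨x, y, y, x, Or.inl fun v hv => ?_⟩
      have h1 := hI2 v hv
      have h2 := hx v hv
      have h3 := hy v hv
      simp only [classWeight]; grind
    by_cases hI3 : ∀ b ∈ S, t₁ b = 0 → 2 ≤ t₂ b ∨ c₃ b = c₃ d ∧ 1 ≤ t₃ b
    · refine ⟨x, y, c₃ d, x, Or.inl fun v hv => ?_⟩
      have h1 := hI3 v hv
      have h2 := hx v hv
      have h3 := hy v hv
      have h4 := hI v hv
      simp only [classWeight]; grind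
    push Not at hI3
    obtain ⟨b, hb, hb1, hb2, hb3⟩ := hI3
    refine ⟨x, y, c₃ d, y, Or.inr (Or.inl fun v hv => ?_)⟩
    have h1 := H v hv b hb
    have h2 := hx v hv
    have h3 := hy v hv
    have h4 := hI v hv
    have h5 := H d hd b hb
    have h6 := hy b hb hb1
    simp only [classWeight]; grind
  push Not at hI
  obtain ⟨b, hb, hb1, hb2⟩ := hI
  by_cases hII1 : ∃ b ∈ S, t₁ b = 0 ∧ t₂ b = 0 ∧ t₃ b ≤ 1
  · obtain ⟨b, hb, hb1, hb2, hb3⟩ := hII1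
    refine ⟨x, y, c₃ b, c₃ b, Or.inr (Or.inr fun v hv => ?_)⟩
    have h1 := H v hv b hb
    have h2 := hx v hv
    have h3 := hy v hv
    have h6 := hy b hb hb1
    simp only [classWeight]; grind
  push Not at hII1
  by_cases hII2 : ∀ b ∈ S, t₁ b = 0 → t₂ b = 1 → 1 ≤ t₃ b
  · refine ⟨x, y, c₃ b, x, Or.inl fun v hv => ?_⟩
    have h1 := H v hv b hb
    have h2 := hx v hv
    have h3 := hy v hv
    have h4 := hII2 v hv
    have h5 := hII1 v hv
    simp only [classWeight]; grind
  push Not at hII2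
  obtain ⟨b', hb', hb1', hb2', hb3'⟩ := hII2
  refine ⟨x, y, c₃ b, y, Or.inr (Or.inl fun v hv => ?_)⟩
  have h1 := H v hv b' hb'
  have h0 := H b hb b' hb'
  have h0' := H v hv b hb
  have h2 := hx v hv
  have h3 := hy v hv
  have h5 := hII1 v hv
  have h6 := hy b' hb'
  simp only [classWeight]; grind

lemma fourClassCover_of_spanning {V ι : Type*} {c₁ c₂ c₃ : V → ι} {t₁ t₂ t₃ : V → ℕ}
    {S : Finset V}
    (H : ∀ u ∈ S, ∀ v ∈ S, Covers c₁ t₁ u v ∨ Covers c₂ t₂ u v ∨ Covers c₃ t₃ u v)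
    {x : ι} (hx : ∀ v ∈ S, c₁ v = x) : FourClassCover c₁ c₂ c₃ t₁ t₂ t₃ S := by
  by_cases h2 : ∃ y, ∀ v ∈ S, t₁ v = 0 → c₂ v = y
  · obtain ⟨y, hy⟩ := h2
    exact fourClassCover_of_spanning_aux H hx hy
  by_cases h3 : ∃ y, ∀ v ∈ S, t₁ v = 0 → c₃ v = y
  · obtain ⟨y, hy⟩ := h3
    refine (fourClassCover_of_spanning_aux (c₂ := c₃) (t₂ := t₃) (c₃ := c₂) (t₃ := t₂) ?_
      hx hy).swap₂₃
    intro u hu v hv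
    have := H u hu v hv
    tauto
  exfalso
  push Not at h2 h3
  obtain ⟨a, ha, ha0, -⟩ := h2 x
  obtain ⟨b, hb, hb0, hab⟩ := h2 (c₂ a)
  obtain ⟨d, hd, hd0, had⟩ := h3 (c₃ a)
  have h1 := H a ha b hb
  have h2 := H a ha d hd
  have h3 := H b hb d hd
  unfold Covers at *
  grind

lemma fourClassCover_of_light {V ι : Type*} {c₁ c₂ c₃ : V → ι} {t₁ t₂ t₃ : V → ℕ} {S : Finset V}
    (H : ∀ u ∈ S, ∀ v ∈ S, Covers c₁ t₁ u v ∨ Covers c₂ t₂ u v ∨ Covers c₃ t₃ u v)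
    {z : V} (hz : z ∈ S) (h1 : t₁ z ≤ 1) (h2 : t₂ z = 0) (h3 : t₃ z = 0) :
    FourClassCover c₁ c₂ c₃ t₁ t₂ t₃ S := by
  refine ⟨c₁ z, c₂ z, c₃ z, c₁ z, Or.inl fun v hv => ?_⟩
  have := H v hv z hz
  simp only [classWeight, Covers] at *; grind

lemma fourClassCover_of_majority_aux {V ι : Type*} {c₁ c₂ c₃ : V → ι} {t₁ t₂ t₃ : V → ℕ}
    {S : Finset V}
    (H : ∀ u ∈ S, ∀ v ∈ S, Covers c₁ t₁ u v ∨ Covers c₂ t₂ u v ∨ Covers c₃ t₃ u v)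
    {x₁ x₂ x₃ : ι}
    (hx : ∀ v ∈ S, c₁ v = x₁ ∧ c₂ v = x₂ ∨ c₁ v = x₁ ∧ c₃ v = x₃ ∨ c₂ v = x₂ ∧ c₃ v = x₃)
    (hz : ∀ v ∈ S, c₁ v = x₁ → c₂ v = x₂ → c₃ v = x₃ → 2 ≤ t₁ v + t₂ v + t₃ v)
    {y : V} (hy : y ∈ S) (hy1 : c₁ y ≠ x₁) (hy2 : t₂ y ≤ 1) (hy3 : t₃ y = 0) :
    FourClassCover c₁ c₂ c₃ t₁ t₂ t₃ S := by
  have hxy := hx y hy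
  by_cases hA : ∃ y ∈ S, c₁ y ≠ x₁ ∧ t₂ y = 0 ∧ t₃ y = 0
  · by_cases hA1 : ∃ y ∈ S, c₁ y ≠ x₁ ∧ t₂ y = 0 ∧ t₃ y = 0 ∧ t₁ y ≤ 1
    · obtain ⟨y, hy, hy1, hy2, hy3, hy4⟩ := hA1
      refine ⟨c₁ y, x₂, x₃, c₁ y, Or.inl fun v hv => ?_⟩
      have h1 := H v hv y hy
      have h2 := hx v hv
      have h3 := hx y hy
      simp only [classWeight, Covers] at *; grind
    push Not at hA1
    obtain ⟨y, hy, hy1, hy2, hy3⟩ := hA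
    by_cases hu : ∃ u ∈ S, c₁ u ≠ x₁ ∧ t₂ u ≤ 1 ∧ t₃ u = 0 ∧ t₁ u = 0
    · obtain ⟨u, hu, hu1, hu2, hu3, hu4⟩ := hu
      refine ⟨c₁ y, x₂, x₃, x₂, Or.inr (Or.inl fun v hv => ?_)⟩
      have h0 := H v hv y hy
      have h1 := H v hv u hu
      have h2 := hx v hv
      have h3 := hx y hy
      have h4 := hx u hu
      have h5 := hA1 v hv
      simp only [classWeight, Covers] at *; grind
    · push Not at hu
      refine ⟨c₁ y, x₂, x₃, x₃, Or.inr (Or.inr fun v hv => ?_)⟩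
      have h0 := H v hv y hy
      have h1 := hu v hv
      have h2 := hx v hv
      have h3 := hx y hy
      have h5 := hA1 v hv
      simp only [classWeight, Covers] at *; grind
  push Not at hA
  have hA' := hA y hy hy1
  by_cases hB : ∃ y' ∈ S, c₁ y' ≠ x₁ ∧ t₂ y' = 0 ∧ t₃ y' ≤ 1
  · obtain ⟨y', hy', hy1', hy2', hy3'⟩ := hB
    have hA'' := hA y' hy' hy1'
    have hxy' := hx y' hy'
    have hyy := H y hy y' hy'
    by_cases hB1 : ∃ u ∈ S, c₁ u ≠ x₁ ∧ t₂ u ≤ 1 ∧ t₃ u = 0 ∧ t₁ u = 0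
    · obtain ⟨u, hu, hu1, hu2, hu3, hu4⟩ := hB1
      refine ⟨c₁ y, x₂, x₃, x₂, Or.inr (Or.inl fun v hv => ?_)⟩
      have h0 := H v hv u hu
      have h1 := H v hv y hy
      have h1' := H v hv y' hy'
      have h2 := hx v hv
      have h3 := hx u hu
      have h4 := H u hu y' hy'
      have h5 := hA v hv
      simp only [classWeight, Covers] at *; grind
    by_cases hB2 : ∃ u ∈ S, c₁ u ≠ x₁ ∧ t₂ u = 0 ∧ t₃ u ≤ 1 ∧ t₁ u = 0
    · obtain ⟨u, hu, hu1, hu2, hu3, hu4⟩ := hB2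
      refine ⟨c₁ y, x₂, x₃, x₃, Or.inr (Or.inr fun v hv => ?_)⟩
      have h0 := H v hv u hu
      have h1 := H v hv y hy
      have h1' := H v hv y' hy'
      have h2 := hx v hv
      have h3 := hx u hu
      have h4 := H u hu y hy
      have h5 := hA v hv
      simp only [classWeight, Covers] at *; grind
    refine ⟨c₁ y, x₂, x₃, x₃, Or.inr (Or.inr fun v hv => ?_)⟩
    push Not at hB1 hB2
    have h0 := hB1 v hv
    have h0' := hB2 v hv
    have h1 := H v hv y hy
    have h1' := H v hv y' hy'
    have h2 := hx v hv
    have h5 := hA v hv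
    simp only [classWeight, Covers] at *; grind
  push Not at hB
  refine ⟨x₁, x₂, x₃, x₂, Or.inr (Or.inl fun v hv => ?_)⟩
  have h0 := hB v hv
  have h1 := H v hv y hy
  have h2 := hx v hv
  have h3 := hz v hv
  simp only [classWeight, Covers] at *; grind

lemma fourClassCover_of_majority {V ι : Type*} {c₁ c₂ c₃ : V → ι} {t₁ t₂ t₃ : V → ℕ}
    {S : Finset V}
    (H : ∀ u ∈ S, ∀ v ∈ S, Covers c₁ t₁ u v ∨ Covers c₂ t₂ u v ∨ Covers c₃ t₃ u v)
    {x₁ x₂ x₃ : ι}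
    (hx : ∀ v ∈ S, c₁ v = x₁ ∧ c₂ v = x₂ ∨ c₁ v = x₁ ∧ c₃ v = x₃ ∨ c₂ v = x₂ ∧ c₃ v = x₃) :
    FourClassCover c₁ c₂ c₃ t₁ t₂ t₃ S := by
  have H₁₂ : ∀ u ∈ S, ∀ v ∈ S, Covers c₂ t₂ u v ∨ Covers c₁ t₁ u v ∨ Covers c₃ t₃ u v := by
    intro u hu v hv; have := H u hu v hv; tauto
  have H₂₃ : ∀ u ∈ S, ∀ v ∈ S, Covers c₁ t₁ u v ∨ Covers c₃ t₃ u v ∨ Covers c₂ t₂ u v := by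
    intro u hu v hv; have := H u hu v hv; tauto
  have H₂₃₁ : ∀ u ∈ S, ∀ v ∈ S, Covers c₂ t₂ u v ∨ Covers c₃ t₃ u v ∨ Covers c₁ t₁ u v := by
    intro u hu v hv; have := H u hu v hv; tauto
  have H₃₁₂ : ∀ u ∈ S, ∀ v ∈ S, Covers c₃ t₃ u v ∨ Covers c₁ t₁ u v ∨ Covers c₂ t₂ u v := by
    intro u hu v hv; have := H u hu v hv; tauto
  have H₃₂₁ : ∀ u ∈ S, ∀ v ∈ S, Covers c₃ t₃ u v ∨ Covers c₂ t₂ u v ∨ Covers c₁ t₁ u v := by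
    intro u hu v hv; have := H u hu v hv; tauto
  by_cases hz : ∃ z ∈ S, t₁ z + t₂ z + t₃ z ≤ 1
  · obtain ⟨z, hzS, hz⟩ := hz
    obtain ⟨h1, h2, h3⟩ | ⟨h1, h2, h3⟩ | ⟨h1, h2, h3⟩ :
      (t₁ z ≤ 1 ∧ t₂ z = 0 ∧ t₃ z = 0) ∨ (t₂ z ≤ 1 ∧ t₁ z = 0 ∧ t₃ z = 0) ∨
      (t₃ z ≤ 1 ∧ t₁ z = 0 ∧ t₂ z = 0) := by omega
    · exact fourClassCover_of_light H hzS h1 h2 h3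
    · exact (fourClassCover_of_light H₁₂ hzS h1 h2 h3).swap₁₂
    · exact (fourClassCover_of_light H₃₁₂ hzS h1 h2 h3).swap₁₂.swap₂₃
  push Not at hz
  by_cases hY : ∀ v ∈ S,
      2 ≤ classWeight c₁ t₁ x₁ v + classWeight c₂ t₂ x₂ v + classWeight c₃ t₃ x₃ v
  · refine ⟨x₁, x₂, x₃, x₁, Or.inl fun v hv => ?_⟩
    have := hY v hv; omega
  push Not at hY
  obtain ⟨y, hy, hyw⟩ := hY
  have hxy := hx y hy
  have hzy := hz y hy
  obtain ⟨h1, h2, h3⟩ | ⟨h1, h2, h3⟩ | ⟨h1, h2, h3⟩ | ⟨h1, h2, h3⟩ | ⟨h1, h2, h3⟩ | ⟨h1, h2, h3⟩ :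
      (c₁ y ≠ x₁ ∧ t₂ y ≤ 1 ∧ t₃ y = 0) ∨ (c₁ y ≠ x₁ ∧ t₃ y ≤ 1 ∧ t₂ y = 0) ∨
      (c₂ y ≠ x₂ ∧ t₁ y ≤ 1 ∧ t₃ y = 0) ∨ (c₂ y ≠ x₂ ∧ t₃ y ≤ 1 ∧ t₁ y = 0) ∨
      (c₃ y ≠ x₃ ∧ t₁ y ≤ 1 ∧ t₂ y = 0) ∨ (c₃ y ≠ x₃ ∧ t₂ y ≤ 1 ∧ t₁ y = 0) := by
    simp only [classWeight] at hyw; grind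
  · refine fourClassCover_of_majority_aux H (x₁ := x₁) (x₂ := x₂) (x₃ := x₃) ?_ ?_ hy h1 h2 h3
    · intro v hv; have := hx v hv; tauto
    · intro v hv; have := hz v hv; omega
  · refine (fourClassCover_of_majority_aux H₂₃ (x₁ := x₁) (x₂ := x₃) (x₃ := x₂) ?_ ?_ hy
      h1 h2 h3).swap₂₃
    · intro v hv; have := hx v hv; tauto
    · intro v hv; have := hz v hv; omega
  · refine (fourClassCover_of_majority_aux H₁₂ (x₁ := x₂) (x₂ := x₁) (x₃ := x₃) ?_ ?_ hy
      h1 h2 h3).swap₁₂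
    · intro v hv; have := hx v hv; tauto
    · intro v hv; have := hz v hv; omega
  · refine (fourClassCover_of_majority_aux H₂₃₁ (x₁ := x₂) (x₂ := x₃) (x₃ := x₁) ?_ ?_ hy
      h1 h2 h3).swap₂₃.swap₁₂
    · intro v hv; have := hx v hv; tauto
    · intro v hv; have := hz v hv; omega
  · refine (fourClassCover_of_majority_aux H₃₁₂ (x₁ := x₃) (x₂ := x₁) (x₃ := x₂) ?_ ?_ hy
      h1 h2 h3).swap₁₂.swap₂₃
    · intro v hv; have := hx v hv; tauto
    · intro v hv; have := hz v hv; omega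
  · refine (fourClassCover_of_majority_aux H₃₂₁ (x₁ := x₃) (x₂ := x₂) (x₃ := x₁) ?_ ?_ hy
      h1 h2 h3).swap₁₂.swap₂₃.swap₁₂
    · intro v hv; have := hx v hv; tauto
    · intro v hv; have := hz v hv; omega

lemma sum_class_le {V ι : Type*} {c : V → ι} {t : V → ℕ} {S : Finset V} {b : ℝ}
    (hb : ∀ x, ∑ v ∈ S, (classWeight c t x v : ℝ) ≤ b) {x : ι} {A : Finset V} (hA : A ⊆ S)
    (hx : ∀ v ∈ A, c v = x) : ∑ v ∈ A, (t v : ℝ) ≤ b := by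
  refine le_trans ?_ (hb x)
  calc ∑ v ∈ A, (t v : ℝ) = ∑ v ∈ A, (classWeight c t x v : ℝ) :=
        Finset.sum_congr rfl fun v hv => by simp [classWeight, hx v hv]
    _ ≤ _ := Finset.sum_le_sum_of_subset_of_nonneg hA fun _ _ _ => by positivity

lemma mul_card_le_sum {V : Type*} {t : V → ℕ} {A : Finset V} {k : ℕ} (h : ∀ v ∈ A, k ≤ t v) :
    (k : ℝ) * A.card ≤ ∑ v ∈ A, (t v : ℝ) := by
  have := Finset.card_nsmul_le_sum A (fun v => (t v : ℝ)) k fun v hv => by exact_mod_cast h v hv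
  simpa [mul_comm] using this

lemma two_mul_card_le_sum_add_sum {V : Type*} {t : V → ℕ} {A B : Finset V}
    (h : ∀ u ∈ A, ∀ v ∈ B, 2 ≤ t u + t v) (hAB : B.card ≤ A.card) :
    2 * (B.card : ℝ) ≤ ∑ v ∈ A, (t v : ℝ) + ∑ v ∈ B, (t v : ℝ) := by
  have hA0 : 0 ≤ ∑ v ∈ A, (t v : ℝ) := Finset.sum_nonneg fun _ _ => by positivity
  have hB0 : 0 ≤ ∑ v ∈ B, (t v : ℝ) := Finset.sum_nonneg fun _ _ => by positivity
  have hAB' : (B.card : ℝ) ≤ A.card := by exact_mod_cast hAB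
  by_cases hA : ∃ u ∈ A, t u = 0
  · obtain ⟨u, hu, hu0⟩ := hA
    have := mul_card_le_sum (t := t) (A := B) (k := 2) fun v hv => by have := h u hu v hv; omega
    push_cast at this; linarith
  by_cases hB : ∃ u ∈ B, t u = 0
  · obtain ⟨u, hu, hu0⟩ := hB
    have := mul_card_le_sum (t := t) (A := A) (k := 2) fun v hv => by have := h v hv u hu; omega
    push_cast at this; linarith
  push Not at hA hB
  have h1 := mul_card_le_sum (t := t) (A := A) (k := 1) fun v hv => by have := hA v hv; omega
  have h2 := mul_card_le_sum (t := t) (A := B) (k := 1) fun v hv => by have := hB v hv; omega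
  push_cast at h1 h2; linarith

lemma FourClassCover.two_mul_card_le {V ι : Type*} {c₁ c₂ c₃ : V → ι} {t₁ t₂ t₃ : V → ℕ}
    {S : Finset V} {b₁ b₂ b₃ M : ℝ} (h : FourClassCover c₁ c₂ c₃ t₁ t₂ t₃ S)
    (hb₁ : ∀ x, ∑ v ∈ S, (classWeight c₁ t₁ x v : ℝ) ≤ b₁)
    (hb₂ : ∀ x, ∑ v ∈ S, (classWeight c₂ t₂ x v : ℝ) ≤ b₂)
    (hb₃ : ∀ x, ∑ v ∈ S, (classWeight c₃ t₃ x v : ℝ) ≤ b₃)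
    (h₁ : b₁ ≤ M) (h₂ : b₂ ≤ M) (h₃ : b₃ ≤ M) : 2 * (S.card : ℝ) ≤ b₁ + b₂ + b₃ + M := by
  obtain ⟨x₁, x₂, x₃, x, h⟩ := h
  have e1 := hb₁ x₁
  have e2 := hb₂ x₂
  have e3 := hb₃ x₃
  rcases h with h | h | h
  · have := mul_card_le_sum h
    simp only [Nat.cast_add, Finset.sum_add_distrib] at this
    have := hb₁ x
    push_cast at *; linarith
  · have := mul_card_le_sum h
    simp only [Nat.cast_add, Finset.sum_add_distrib] at this
    have := hb₂ x
    push_cast at *; linarith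
  · have := mul_card_le_sum h
    simp only [Nat.cast_add, Finset.sum_add_distrib] at this
    have := hb₃ x
    push_cast at *; linarith

lemma two_mul_card_le_of_fano_aux {V ι : Type*} {c₁ c₂ c₃ : V → ι} {t₁ t₂ t₃ : V → ℕ}
    {S : Finset V} {b₁ b₂ b₃ M : ℝ}
    (H : ∀ u ∈ S, ∀ v ∈ S, Covers c₁ t₁ u v ∨ Covers c₂ t₂ u v ∨ Covers c₃ t₃ u v)
    (hb₁ : ∀ x, ∑ v ∈ S, (classWeight c₁ t₁ x v : ℝ) ≤ b₁)
    (hb₂ : ∀ x, ∑ v ∈ S, (classWeight c₂ t₂ x v : ℝ) ≤ b₂)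
    (hb₃ : ∀ x, ∑ v ∈ S, (classWeight c₃ t₃ x v : ℝ) ≤ b₃)
    (h₁ : b₁ ≤ M) (h₂ : b₂ ≤ M) (h₃ : b₃ ≤ M)
    {x₁ y₁ x₂ y₂ x₃ y₃ : ι} (n₁ : x₁ ≠ y₁) (n₂ : x₂ ≠ y₂) (n₃ : x₃ ≠ y₃)
    {X₁ X₂ X₃ X₄ : Finset V} (hS₁ : X₁ ⊆ S) (hS₂ : X₂ ⊆ S) (hS₃ : X₃ ⊆ S) (hS₄ : X₄ ⊆ S)
    (hS : ∀ v ∈ S, v ∈ X₁ ∨ v ∈ X₂ ∨ v ∈ X₃ ∨ v ∈ X₄)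
    (hcard : S.card = X₁.card + X₂.card + X₃.card + X₄.card)
    (hX₁ : ∀ v ∈ X₁, c₁ v = x₁ ∧ c₂ v = x₂ ∧ c₃ v = x₃)
    (hX₂ : ∀ v ∈ X₂, c₁ v = x₁ ∧ c₂ v = y₂ ∧ c₃ v = y₃)
    (hX₃ : ∀ v ∈ X₃, c₁ v = y₁ ∧ c₂ v = x₂ ∧ c₃ v = y₃)
    (hX₄ : ∀ v ∈ X₄, c₁ v = y₁ ∧ c₂ v = y₂ ∧ c₃ v = x₃)
    (l₂ : X₂.card ≤ X₁.card) (l₃ : X₃.card ≤ X₁.card) (l₄ : X₄.card ≤ X₁.card) :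
    2 * (S.card : ℝ) ≤ b₁ + b₂ + b₃ + M := by
  classical
  have hcard' : (S.card : ℝ) = X₁.card + X₂.card + X₃.card + X₄.card := by exact_mod_cast hcard
  have E₁ : ∀ u ∈ X₁, ∀ v ∈ X₂, 2 ≤ t₁ u + t₁ v := fun u hu v hv => by
    have := H u (hS₁ hu) v (hS₂ hv)
    have := hX₁ u hu
    have := hX₂ v hv
    simp only [Covers] at *; grind
  have E₂ : ∀ u ∈ X₁, ∀ v ∈ X₃, 2 ≤ t₂ u + t₂ v := fun u hu v hv => by
    have := H u (hS₁ hu) v (hS₃ hv)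
    have := hX₁ u hu
    have := hX₃ v hv
    simp only [Covers] at *; grind
  have E₃ : ∀ u ∈ X₁, ∀ v ∈ X₄, 2 ≤ t₃ u + t₃ v := fun u hu v hv => by
    have := H u (hS₁ hu) v (hS₄ hv)
    have := hX₁ u hu
    have := hX₄ v hv
    simp only [Covers] at *; grind
  have s₁ : ∑ v ∈ X₁, (t₁ v : ℝ) + ∑ v ∈ X₂, (t₁ v : ℝ) ≤ b₁ := by
    rw [← Finset.sum_union (Finset.disjoint_left.2 fun v hv hv' => n₂ (by
      rw [← (hX₁ v hv).2.1, (hX₂ v hv').2.1]))]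
    exact sum_class_le hb₁ (Finset.union_subset hS₁ hS₂) (x := x₁) fun v hv =>
      (Finset.mem_union.1 hv).elim (fun h => (hX₁ v h).1) fun h => (hX₂ v h).1
  have s₂ : ∑ v ∈ X₁, (t₂ v : ℝ) + ∑ v ∈ X₃, (t₂ v : ℝ) ≤ b₂ := by
    rw [← Finset.sum_union (Finset.disjoint_left.2 fun v hv hv' => n₁ (by
      rw [← (hX₁ v hv).1, (hX₃ v hv').1]))]
    exact sum_class_le hb₂ (Finset.union_subset hS₁ hS₃) (x := x₂) fun v hv =>
      (Finset.mem_union.1 hv).elim (fun h => (hX₁ v h).2.1) fun h => (hX₃ v h).2.1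
  have s₃ : ∑ v ∈ X₁, (t₃ v : ℝ) + ∑ v ∈ X₄, (t₃ v : ℝ) ≤ b₃ := by
    rw [← Finset.sum_union (Finset.disjoint_left.2 fun v hv hv' => n₁ (by
      rw [← (hX₁ v hv).1, (hX₄ v hv').1]))]
    exact sum_class_le hb₃ (Finset.union_subset hS₁ hS₄) (x := x₃) fun v hv =>
      (Finset.mem_union.1 hv).elim (fun h => (hX₁ v h).2.2) fun h => (hX₄ v h).2.2
  have w₁ := two_mul_card_le_sum_add_sum E₁ l₂
  have w₂ := two_mul_card_le_sum_add_sum E₂ l₃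
  have w₃ := two_mul_card_le_sum_add_sum E₃ l₄
  have nn : ∀ (t : V → ℕ) (A : Finset V), 0 ≤ ∑ v ∈ A, (t v : ℝ) := fun t A =>
    Finset.sum_nonneg fun _ _ => by positivity
  by_cases i₁ : ∀ v ∈ X₁, 2 ≤ t₁ v
  · have := mul_card_le_sum i₁
    have := nn t₁ X₂
    push_cast at *; linarith
  by_cases i₂ : ∀ v ∈ X₁, 2 ≤ t₂ v
  · have := mul_card_le_sum i₂
    have := nn t₂ X₃
    push_cast at *; linarith
  by_cases i₃ : ∀ v ∈ X₁, 2 ≤ t₃ v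
  · have := mul_card_le_sum i₃
    have := nn t₃ X₄
    push_cast at *; linarith
  push Not at i₁ i₂ i₃
  obtain ⟨u₁, hu₁, hu₁'⟩ := i₁
  obtain ⟨u₂, hu₂, hu₂'⟩ := i₂
  obtain ⟨u₃, hu₃, hu₃'⟩ := i₃
  have f₁ : ∀ v ∈ X₂, 1 ≤ t₁ v := fun v hv => by have := E₁ u₁ hu₁ v hv; omega
  have f₂ : ∀ v ∈ X₃, 1 ≤ t₂ v := fun v hv => by have := E₂ u₂ hu₂ v hv; omega
  have f₃ : ∀ v ∈ X₄, 1 ≤ t₃ v := fun v hv => by have := E₃ u₃ hu₃ v hv; omega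
  have f₁' := mul_card_le_sum f₁
  have f₂' := mul_card_le_sum f₂
  have f₃' := mul_card_le_sum f₃
  have cover : FourClassCover c₁ c₂ c₃ t₁ t₂ t₃ S → 2 * (S.card : ℝ) ≤ b₁ + b₂ + b₃ + M :=
    fun h => h.two_mul_card_le hb₁ hb₂ hb₃ h₁ h₂ h₃
  by_cases j₁ : ∀ v ∈ X₁, 1 ≤ t₁ v
  · have j₁' := mul_card_le_sum j₁
    by_cases j₂ : ∀ v ∈ X₁, 1 ≤ t₂ v
    · have j₂' := mul_card_le_sum j₂
      push_cast at *; linarith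
    by_cases j₃ : ∀ v ∈ X₁, 1 ≤ t₃ v
    · have j₃' := mul_card_le_sum j₃
      push_cast at *; linarith
    push Not at j₂ j₃
    obtain ⟨z₂, hz₂, hz₂'⟩ := j₂
    obtain ⟨z₃, hz₃, hz₃'⟩ := j₃
    refine cover ⟨x₁, x₂, x₃, x₁, Or.inl fun v hv => ?_⟩
    have := hS v hv
    have := j₁ v
    have := E₂ z₂ hz₂ v
    have := E₃ z₃ hz₃ v
    simp only [classWeight]; grind
  by_cases j₂ : ∀ v ∈ X₁, 1 ≤ t₂ v
  · have j₂' := mul_card_le_sum j₂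
    by_cases j₃ : ∀ v ∈ X₁, 1 ≤ t₃ v
    · have j₃' := mul_card_le_sum j₃
      push_cast at *; linarith
    push Not at j₁ j₃
    obtain ⟨z₁, hz₁, hz₁'⟩ := j₁
    obtain ⟨z₃, hz₃, hz₃'⟩ := j₃
    refine cover ⟨x₁, x₂, x₃, x₂, Or.inr (Or.inl fun v hv => ?_)⟩
    have := hS v hv
    have := j₂ v
    have := E₁ z₁ hz₁ v
    have := E₃ z₃ hz₃ v
    simp only [classWeight]; grind
  push Not at j₁ j₂
  obtain ⟨z₁, hz₁, hz₁'⟩ := j₁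
  obtain ⟨z₂, hz₂, hz₂'⟩ := j₂
  by_cases j₃ : ∀ v ∈ X₁, 1 ≤ t₃ v
  · refine cover ⟨x₁, x₂, x₃, x₃, Or.inr (Or.inr fun v hv => ?_)⟩
    have := hS v hv
    have := j₃ v
    have := E₁ z₁ hz₁ v
    have := E₂ z₂ hz₂ v
    simp only [classWeight]; grind
  push Not at j₃
  obtain ⟨z₃, hz₃, hz₃'⟩ := j₃
  by_cases k : ∀ v ∈ X₁, 2 ≤ t₁ v + t₂ v + t₃ v
  · refine cover ⟨x₁, x₂, x₃, x₃, Or.inr (Or.inr fun v hv => ?_)⟩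
    have := hS v hv
    have := k v
    have := E₁ z₁ hz₁ v
    have := E₂ z₂ hz₂ v
    have := E₃ z₃ hz₃ v
    simp only [classWeight]; grind
  push Not at k
  obtain ⟨z, hz, hz'⟩ := k
  obtain ⟨h1, h2, h3⟩ | ⟨h1, h2, h3⟩ | ⟨h1, h2, h3⟩ :
      (t₁ z ≤ 1 ∧ t₂ z = 0 ∧ t₃ z = 0) ∨ (t₂ z ≤ 1 ∧ t₁ z = 0 ∧ t₃ z = 0) ∨
      (t₃ z ≤ 1 ∧ t₁ z = 0 ∧ t₂ z = 0) := by omega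
  · exact cover (fourClassCover_of_light H (hS₁ hz) h1 h2 h3)
  · refine cover (fourClassCover_of_light ?_ (hS₁ hz) h1 h2 h3).swap₁₂
    intro u hu v hv; have := H u hu v hv; tauto
  · refine cover (fourClassCover_of_light ?_ (hS₁ hz) h1 h2 h3).swap₁₂.swap₂₃
    intro u hu v hv; have := H u hu v hv; tauto

lemma two_mul_card_le_of_fano {V ι : Type*} {c₁ c₂ c₃ : V → ι} {t₁ t₂ t₃ : V → ℕ}
    {S : Finset V} {b₁ b₂ b₃ M : ℝ}
    (H : ∀ u ∈ S, ∀ v ∈ S, Covers c₁ t₁ u v ∨ Covers c₂ t₂ u v ∨ Covers c₃ t₃ u v)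
    (hb₁ : ∀ x, ∑ v ∈ S, (classWeight c₁ t₁ x v : ℝ) ≤ b₁)
    (hb₂ : ∀ x, ∑ v ∈ S, (classWeight c₂ t₂ x v : ℝ) ≤ b₂)
    (hb₃ : ∀ x, ∑ v ∈ S, (classWeight c₃ t₃ x v : ℝ) ≤ b₃)
    (h₁ : b₁ ≤ M) (h₂ : b₂ ≤ M) (h₃ : b₃ ≤ M)
    {x₁ y₁ x₂ y₂ x₃ y₃ : ι} (n₁ : x₁ ≠ y₁) (n₂ : x₂ ≠ y₂) (n₃ : x₃ ≠ y₃)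
    (hS : ∀ v ∈ S, (c₁ v = x₁ ∧ c₂ v = x₂ ∧ c₃ v = x₃) ∨ (c₁ v = x₁ ∧ c₂ v = y₂ ∧ c₃ v = y₃) ∨
      (c₁ v = y₁ ∧ c₂ v = x₂ ∧ c₃ v = y₃) ∨ (c₁ v = y₁ ∧ c₂ v = y₂ ∧ c₃ v = x₃)) :
    2 * (S.card : ℝ) ≤ b₁ + b₂ + b₃ + M := by
  classical
  set X₁ := S.filter fun v => c₁ v = x₁ ∧ c₂ v = x₂ ∧ c₃ v = x₃ with hX₁
  set X₂ := S.filter fun v => c₁ v = x₁ ∧ c₂ v = y₂ ∧ c₃ v = y₃ with hX₂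
  set X₃ := S.filter fun v => c₁ v = y₁ ∧ c₂ v = x₂ ∧ c₃ v = y₃ with hX₃
  set X₄ := S.filter fun v => c₁ v = y₁ ∧ c₂ v = y₂ ∧ c₃ v = x₃ with hX₄
  have m₁ : ∀ v ∈ X₁, c₁ v = x₁ ∧ c₂ v = x₂ ∧ c₃ v = x₃ := fun v hv => (Finset.mem_filter.1 hv).2
  have m₂ : ∀ v ∈ X₂, c₁ v = x₁ ∧ c₂ v = y₂ ∧ c₃ v = y₃ := fun v hv => (Finset.mem_filter.1 hv).2
  have m₃ : ∀ v ∈ X₃, c₁ v = y₁ ∧ c₂ v = x₂ ∧ c₃ v = y₃ := fun v hv => (Finset.mem_filter.1 hv).2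
  have m₄ : ∀ v ∈ X₄, c₁ v = y₁ ∧ c₂ v = y₂ ∧ c₃ v = x₃ := fun v hv => (Finset.mem_filter.1 hv).2
  have u₁ : X₁ ⊆ S := Finset.filter_subset _ _
  have u₂ : X₂ ⊆ S := Finset.filter_subset _ _
  have u₃ : X₃ ⊆ S := Finset.filter_subset _ _
  have u₄ : X₄ ⊆ S := Finset.filter_subset _ _
  have cov : ∀ v ∈ S, v ∈ X₁ ∨ v ∈ X₂ ∨ v ∈ X₃ ∨ v ∈ X₄ := fun v hv => by
    have := hS v hv
    simp only [hX₁, hX₂, hX₃, hX₄, Finset.mem_filter]; tauto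
  have hcard : S.card = X₁.card + X₂.card + X₃.card + X₄.card := by
    have : S = X₁ ∪ X₂ ∪ X₃ ∪ X₄ := by
      ext v; simp only [Finset.mem_union]
      constructor
      · intro hv; have := cov v hv; tauto
      · rintro (((h | h) | h) | h)
        exacts [u₁ h, u₂ h, u₃ h, u₄ h]
    conv_lhs => rw [this]
    rw [Finset.card_union_of_disjoint, Finset.card_union_of_disjoint,
      Finset.card_union_of_disjoint]
    all_goals
      rw [Finset.disjoint_left]
      intro v
      simp only [hX₁, hX₂, hX₃, hX₄, Finset.mem_filter, Finset.mem_union]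
      grind
  obtain ⟨l₂, l₃, l₄⟩ | ⟨l₂, l₃, l₄⟩ | ⟨l₂, l₃, l₄⟩ | ⟨l₂, l₃, l₄⟩ :
      (X₂.card ≤ X₁.card ∧ X₃.card ≤ X₁.card ∧ X₄.card ≤ X₁.card) ∨
      (X₁.card ≤ X₂.card ∧ X₄.card ≤ X₂.card ∧ X₃.card ≤ X₂.card) ∨
      (X₄.card ≤ X₃.card ∧ X₁.card ≤ X₃.card ∧ X₂.card ≤ X₃.card) ∨
      (X₃.card ≤ X₄.card ∧ X₂.card ≤ X₄.card ∧ X₁.card ≤ X₄.card) := by omega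
  · exact two_mul_card_le_of_fano_aux H hb₁ hb₂ hb₃ h₁ h₂ h₃ n₁ n₂ n₃ u₁ u₂ u₃ u₄ cov hcard
      m₁ m₂ m₃ m₄ l₂ l₃ l₄
  · exact two_mul_card_le_of_fano_aux H hb₁ hb₂ hb₃ h₁ h₂ h₃ n₁ n₂.symm n₃.symm u₂ u₁ u₄ u₃
      (fun v hv => by have := cov v hv; tauto) (by omega) m₂ m₁ m₄ m₃ l₂ l₃ l₄
  · exact two_mul_card_le_of_fano_aux H hb₁ hb₂ hb₃ h₁ h₂ h₃ n₁.symm n₂ n₃.symm u₃ u₄ u₁ u₂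
      (fun v hv => by have := cov v hv; tauto) (by omega) m₃ m₄ m₁ m₂ l₂ l₃ l₄
  · exact two_mul_card_le_of_fano_aux H hb₁ hb₂ hb₃ h₁ h₂ h₃ n₁.symm n₂.symm n₃ u₄ u₃ u₂ u₁
      (fun v hv => by have := cov v hv; tauto) (by omega) m₄ m₃ m₂ m₁ l₂ l₃ l₄

lemma fano_of_triple {V ι : Type*} {c₁ c₂ c₃ : V → ι} {S : Finset V}
    (H : ∀ u ∈ S, ∀ v ∈ S, c₁ u = c₁ v ∨ c₂ u = c₂ v ∨ c₃ u = c₃ v)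
    (hm : ¬ ∃ x₁ x₂ x₃, ∀ v ∈ S,
      c₁ v = x₁ ∧ c₂ v = x₂ ∨ c₁ v = x₁ ∧ c₃ v = x₃ ∨ c₂ v = x₂ ∧ c₃ v = x₃)
    {u v w : V} (hu : u ∈ S) (hv : v ∈ S) (hw : w ∈ S)
    (h₁ : c₁ v = c₁ u) (h₂ : c₂ w = c₂ u) (h₃ : c₃ w = c₃ v)
    (n₁ : c₁ w ≠ c₁ u) (n₂ : c₂ v ≠ c₂ u) (n₃ : c₃ v ≠ c₃ u) :
    ∃ x₁ x₂ x₃ y₁ y₂ y₃, x₁ ≠ y₁ ∧ x₂ ≠ y₂ ∧ x₃ ≠ y₃ ∧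
      ∀ v ∈ S, (c₁ v = x₁ ∧ c₂ v = x₂ ∧ c₃ v = x₃) ∨ (c₁ v = x₁ ∧ c₂ v = y₂ ∧ c₃ v = y₃) ∨
      (c₁ v = y₁ ∧ c₂ v = x₂ ∧ c₃ v = y₃) ∨ (c₁ v = y₁ ∧ c₂ v = y₂ ∧ c₃ v = x₃) := by
  push Not at hm
  obtain ⟨z, hz, hz'⟩ := hm (c₁ u) (c₂ u) (c₃ v)
  have a := H z hz u hu
  have b := H z hz v hv
  have c := H z hz w hw
  refine ⟨c₁ u, c₂ u, c₃ u, c₁ w, c₂ v, c₃ v, n₁.symm, n₂.symm, n₃.symm, fun s hs => ?_⟩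
  have a' := H s hs u hu
  have b' := H s hs v hv
  have c' := H s hs w hw
  have d' := H s hs z hz
  have : c₁ z = c₁ w ∧ c₂ z = c₂ v ∧ c₃ z = c₃ u := by grind
  grind

/-- Pairwise agreement in some coordinate forces a spanning class, a majority vote,
or the affine plane of order two. -/
lemma spanning_or_majority_or_fano {V ι : Type*} {c₁ c₂ c₃ : V → ι} {S : Finset V}
    (hne : S.Nonempty)
    (H : ∀ u ∈ S, ∀ v ∈ S, c₁ u = c₁ v ∨ c₂ u = c₂ v ∨ c₃ u = c₃ v)
    (s₁ : ¬ ∃ x, ∀ v ∈ S, c₁ v = x) (s₂ : ¬ ∃ x, ∀ v ∈ S, c₂ v = x)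
    (s₃ : ¬ ∃ x, ∀ v ∈ S, c₃ v = x)
    (hm : ¬ ∃ x₁ x₂ x₃, ∀ v ∈ S,
      c₁ v = x₁ ∧ c₂ v = x₂ ∨ c₁ v = x₁ ∧ c₃ v = x₃ ∨ c₂ v = x₂ ∧ c₃ v = x₃) :
    ∃ x₁ x₂ x₃ y₁ y₂ y₃, x₁ ≠ y₁ ∧ x₂ ≠ y₂ ∧ x₃ ≠ y₃ ∧
      ∀ v ∈ S, (c₁ v = x₁ ∧ c₂ v = x₂ ∧ c₃ v = x₃) ∨ (c₁ v = x₁ ∧ c₂ v = y₂ ∧ c₃ v = y₃) ∨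
      (c₁ v = y₁ ∧ c₂ v = x₂ ∧ c₃ v = y₃) ∨ (c₁ v = y₁ ∧ c₂ v = y₂ ∧ c₃ v = x₃) := by
  obtain ⟨u, hu⟩ := hne
  have hm' := hm
  push Not at s₁ s₂ s₃ hm'
  obtain ⟨v, hv, hv'⟩ := hm' (c₁ u) (c₂ u) (c₃ u)
  have huv := H v hv u hu
  obtain ⟨a, b, c⟩ | ⟨a, b, c⟩ | ⟨a, b, c⟩ :
      (c₁ v = c₁ u ∧ c₂ v ≠ c₂ u ∧ c₃ v ≠ c₃ u) ∨ (c₂ v = c₂ u ∧ c₁ v ≠ c₁ u ∧ c₃ v ≠ c₃ u) ∨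
      (c₃ v = c₃ u ∧ c₁ v ≠ c₁ u ∧ c₂ v ≠ c₂ u) := by grind
  · obtain ⟨w, hw, hw'⟩ := s₁ (c₁ u)
    have hwu := H w hw u hu
    have hwv := H w hw v hv
    obtain ⟨d, e⟩ | ⟨d, e⟩ : (c₂ w = c₂ u ∧ c₃ w = c₃ v) ∨ (c₂ w = c₂ v ∧ c₃ w = c₃ u) := by grind
    · exact fano_of_triple H hm hu hv hw a d e hw' b c
    · exact fano_of_triple H hm hv hu hw a.symm d e (by grind) b.symm c.symm
  · obtain ⟨w, hw, hw'⟩ := s₂ (c₂ u)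
    have hwu := H w hw u hu
    have hwv := H w hw v hv
    obtain ⟨d, e⟩ | ⟨d, e⟩ : (c₁ w = c₁ u ∧ c₃ w = c₃ v) ∨ (c₁ w = c₁ v ∧ c₃ w = c₃ u) := by grind
    · exact fano_of_triple H hm hu hw hv d a e.symm b hw' (by grind)
    · exact fano_of_triple H hm hv hw hu d a.symm e.symm b.symm (by grind) (by grind)
  · obtain ⟨w, hw, hw'⟩ := s₃ (c₃ u)
    have hwu := H w hw u hu
    have hwv := H w hw v hv
    obtain ⟨d, e⟩ | ⟨d, e⟩ : (c₁ w = c₁ u ∧ c₂ w = c₂ v) ∨ (c₁ w = c₁ v ∧ c₂ w = c₂ u) := by grind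
    · exact fano_of_triple H hm hw hu hv d.symm e.symm a (by grind) (by grind) (by grind)
    · exact fano_of_triple H hm hw hv hu d.symm e.symm a.symm (by grind) (by grind) (by grind)

/-- If every pair of points of `S`, equal or not, is covered in some colour, and every class
in colour `i` has total weight at most `b i`, then `2 |S| ≤ b 1 + b 2 + b 3 + M`. -/
theorem two_mul_card_le_of_covers {V ι : Type*} {c₁ c₂ c₃ : V → ι} {t₁ t₂ t₃ : V → ℕ}
    {S : Finset V} {b₁ b₂ b₃ M : ℝ}
    (H : ∀ u ∈ S, ∀ v ∈ S, Covers c₁ t₁ u v ∨ Covers c₂ t₂ u v ∨ Covers c₃ t₃ u v)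
    (hb₁ : ∀ x, ∑ v ∈ S, (classWeight c₁ t₁ x v : ℝ) ≤ b₁)
    (hb₂ : ∀ x, ∑ v ∈ S, (classWeight c₂ t₂ x v : ℝ) ≤ b₂)
    (hb₃ : ∀ x, ∑ v ∈ S, (classWeight c₃ t₃ x v : ℝ) ≤ b₃)
    (h₁ : b₁ ≤ M) (h₂ : b₂ ≤ M) (h₃ : b₃ ≤ M) (hne : S.Nonempty) :
    2 * (S.card : ℝ) ≤ b₁ + b₂ + b₃ + M := by
  have cover : FourClassCover c₁ c₂ c₃ t₁ t₂ t₃ S → 2 * (S.card : ℝ) ≤ b₁ + b₂ + b₃ + M :=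
    fun h => h.two_mul_card_le hb₁ hb₂ hb₃ h₁ h₂ h₃
  by_cases s₁ : ∃ x, ∀ v ∈ S, c₁ v = x
  · obtain ⟨x, hx⟩ := s₁
    exact cover (fourClassCover_of_spanning H hx)
  by_cases s₂ : ∃ x, ∀ v ∈ S, c₂ v = x
  · obtain ⟨x, hx⟩ := s₂
    refine cover (fourClassCover_of_spanning (c₂ := c₁) (c₃ := c₃) (t₂ := t₁) (t₃ := t₃)
      ?_ hx).swap₁₂
    intro u hu v hv; have := H u hu v hv; tauto
  by_cases s₃ : ∃ x, ∀ v ∈ S, c₃ v = x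
  · obtain ⟨x, hx⟩ := s₃
    refine cover (fourClassCover_of_spanning (c₂ := c₁) (c₃ := c₂) (t₂ := t₁) (t₃ := t₂)
      ?_ hx).swap₁₂.swap₂₃
    intro u hu v hv; have := H u hu v hv; tauto
  by_cases hm : ∃ x₁ x₂ x₃, ∀ v ∈ S,
      c₁ v = x₁ ∧ c₂ v = x₂ ∨ c₁ v = x₁ ∧ c₃ v = x₃ ∨ c₂ v = x₂ ∧ c₃ v = x₃
  · obtain ⟨x₁, x₂, x₃, hx⟩ := hm
    exact cover (fourClassCover_of_majority H hx)
  obtain ⟨x₁, x₂, x₃, y₁, y₂, y₃, n₁, n₂, n₃, hS⟩ := spanning_or_majority_or_fano hne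
    (fun u hu v hv => by
      rcases H u hu v hv with h | h | h
      exacts [Or.inl h.1, Or.inr (Or.inl h.1), Or.inr (Or.inr h.1)]) s₁ s₂ s₃ hm
  exact two_mul_card_le_of_fano H hb₁ hb₂ hb₃ h₁ h₂ h₃ n₁ n₂ n₃ hS

/-- Along a walk in the reduced graph one can embed a path of the original graph which starts
in a prescribed large set `U`, ends in a prescribed reserved set `T`, and otherwise avoids
the used set `F ⊇ T`. -/
lemma exists_path_along_walk {V κ : Type*} [DecidableEq V] [DecidableEq κ] {G : SimpleGraph V}
    [DecidableRel G.Adj] {R : SimpleGraph κ} {cell : κ → Finset V} {e β : ℕ}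
    (hdisj : ∀ a b, a ≠ b → Disjoint (cell a) (cell b))
    (hR : ∀ a b, R.Adj a b → ∀ U ⊆ cell a, ∀ Y ⊆ cell b, e ≤ U.card → β ≤ Y.card →
      ∃ u ∈ U, 2 * e ≤ (Y.filter (G.Adj u)).card)
    (hR' : ∀ a b, R.Adj a b → ∀ U ⊆ cell a, ∀ Y ⊆ cell b, e ≤ U.card → e ≤ Y.card →
      ∃ u ∈ U, ∃ w ∈ Y, G.Adj u w)
    {b b' : κ} (hb : R.Adj b b') {T : Finset V} (hT : T ⊆ cell b') (hTe : e ≤ T.card) {a : κ}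
    (W : R.Walk a b) :
    ∀ (F : Finset V), T ⊆ F → ∀ U ⊆ cell a \ F, e ≤ U.card →
      (∀ p, (cell p ∩ F).card + W.support.count p + β ≤ (cell p).card) →
      ∃ u ∈ U, ∃ w ∈ T, ∃ q : G.Walk u w, q.IsPath ∧ q.length = W.length + 1 ∧
        ∀ x ∈ q.support, x ∈ F → x = w := by
  induction W with
  | nil =>
    intro F hTF U hU hUe _
    obtain ⟨u, hu, w, hw, huw⟩ := hR' _ _ hb U (hU.trans Finset.sdiff_subset) T hT hUe hTe
    have huF : u ∉ F := (Finset.mem_sdiff.1 (hU hu)).2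
    refine ⟨u, hu, w, hw, .cons huw .nil, ?_, by simp, ?_⟩
    · simp [SimpleGraph.Walk.cons_isPath_iff, huw.ne]
    · intro x hx hxF
      simp only [SimpleGraph.Walk.support_cons, SimpleGraph.Walk.support_nil, List.mem_cons,
        List.not_mem_nil, or_false] at hx
      rcases hx with rfl | rfl
      · exact absurd hxF huF
      · rfl
  | @cons a c b hac W ih =>
    intro F hTF U hU hUe hcount
    have hc := hcount c
    have h1 : (cell c \ F).card + (cell c ∩ F).card = (cell c).card :=
      Finset.card_sdiff_add_card_inter _ _
    obtain ⟨u, hu, hdeg⟩ := hR a c hac U (hU.trans Finset.sdiff_subset) (cell c \ F)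
      Finset.sdiff_subset hUe (by omega)
    have huF : u ∉ F := (Finset.mem_sdiff.1 (hU hu)).2
    have hua : u ∈ cell a := (Finset.mem_sdiff.1 (hU hu)).1
    have huc : u ∉ cell c := Finset.disjoint_left.1 (hdisj _ _ hac.ne) hua
    obtain ⟨u', hu', w, hw, q, hq, hlen, hav⟩ := ih hb (insert u F)
      (hTF.trans (Finset.subset_insert _ _)) ((cell c \ F).filter (G.Adj u))
      (by
        intro x hx
        simp only [Finset.mem_filter, Finset.mem_sdiff] at hx
        simp only [Finset.mem_sdiff, Finset.mem_insert, not_or]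
        exact ⟨hx.1.1, fun h => huc (h ▸ hx.1.1), hx.1.2⟩)
      (by omega)
      (by
        intro p
        have hp := hcount p
        rw [SimpleGraph.Walk.support_cons, List.count_cons] at hp
        have : (cell p ∩ insert u F).card ≤ (cell p ∩ F).card + if a == p then 1 else 0 := by
          by_cases hap : a = p
          · subst hap
            simp only [beq_self_eq_true, if_true]
            rw [Finset.inter_insert_of_mem hua]
            exact Finset.card_insert_le _ _
          · rw [Finset.inter_insert_of_notMem
              (Finset.disjoint_left.1 (hdisj _ _ hap) hua)]
            omega
        omega)
    have huu' : G.Adj u u' := (Finset.mem_filter.1 hu').2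
    have hus : u ∉ q.support := fun h =>
      huF (hTF ((hav u h (Finset.mem_insert_self _ _)).symm ▸ hw))
    refine ⟨u, hu, w, hw, .cons huu' q, ?_, by simp [hlen], ?_⟩
    · rw [SimpleGraph.Walk.cons_isPath_iff]
      exact ⟨hq, hus⟩
    · intro x hx hxF
      rw [SimpleGraph.Walk.support_cons, List.mem_cons] at hx
      rcases hx with rfl | hx
      · exact absurd hxF huF
      · exact hav x hx (Finset.mem_insert_of_mem hxF)

lemma exists_cycle_along_walk {V κ : Type*} [DecidableEq V] [DecidableEq κ] {G : SimpleGraph V}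
    [DecidableRel G.Adj] {R : SimpleGraph κ} {cell : κ → Finset V} {e β : ℕ}
    (hdisj : ∀ a b, a ≠ b → Disjoint (cell a) (cell b))
    (hR : ∀ a b, R.Adj a b → ∀ U ⊆ cell a, ∀ Y ⊆ cell b, e ≤ U.card → β ≤ Y.card →
      ∃ u ∈ U, 2 * e ≤ (Y.filter (G.Adj u)).card)
    (hR' : ∀ a b, R.Adj a b → ∀ U ⊆ cell a, ∀ Y ⊆ cell b, e ≤ U.card → e ≤ Y.card →
      ∃ u ∈ U, ∃ w ∈ Y, G.Adj u w)
    {x y : κ} (hxy : R.Adj x y) (W : R.Walk y x)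
    (hW : ∀ p, W.support.count p + (e + 1 + β) ≤ (cell p).card) :
    ∃ (v : V) (w : G.Walk v v), w.IsCycle ∧ w.length = W.length + 3 := by
  have hx := hW x
  have hy := hW y
  obtain ⟨u₀, hu₀, hdeg⟩ := hR x y hxy (cell x) subset_rfl (cell y) subset_rfl (by omega)
    (by omega)
  obtain ⟨T, hTN, hTe⟩ := Finset.exists_subset_card_eq (s := (cell y).filter (G.Adj u₀))
    (n := e) (by omega)
  have hu₀y : u₀ ∉ cell y := Finset.disjoint_left.1 (hdisj _ _ hxy.ne) hu₀
  obtain ⟨u, hu, w, hw, q, hq, hlen, hav⟩ := exists_path_along_walk hdisj hR hR' hxy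
    (T := T) (fun t ht => (Finset.mem_filter.1 (hTN ht)).1) hTe.ge W (insert u₀ T)
    (Finset.subset_insert _ _) ((cell y).filter (G.Adj u₀) \ T)
    (by
      intro t ht
      simp only [Finset.mem_filter, Finset.mem_sdiff] at ht
      simp only [Finset.mem_sdiff, Finset.mem_insert, not_or]
      exact ⟨ht.1.1, fun h => hu₀y (h ▸ ht.1.1), ht.2⟩)
    (by rw [Finset.card_sdiff_of_subset hTN]; omega)
    (by
      intro p
      have h1 : (cell p ∩ insert u₀ T).card ≤ e + 1 := by
        refine (Finset.card_le_card Finset.inter_subset_right).trans ?_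
        exact (Finset.card_insert_le _ _).trans (by omega)
      have := hW p
      omega)
  have hw' := Finset.mem_filter.1 (hTN hw)
  have hwu₀ : G.Adj w u₀ := hw'.2.symm
  have hu' := Finset.mem_sdiff.1 hu
  have huu₀ : G.Adj u₀ u := (Finset.mem_filter.1 hu'.1).2
  have hu₀q : u₀ ∉ q.support := fun h =>
    hwu₀.ne (hav u₀ h (Finset.mem_insert_self _ _)).symm
  refine ⟨u₀, .cons huu₀ (q.concat hwu₀), ?_, by simp [hlen]⟩
  rw [SimpleGraph.Walk.cons_isCycle_iff]
  refine ⟨hq.concat hu₀q hwu₀, ?_⟩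
  rw [SimpleGraph.Walk.edges_concat, List.concat_eq_append, List.mem_append, List.mem_singleton]
  rintro (h | h)
  · exact hu₀q (q.fst_mem_support_of_mem_edges h)
  · rw [Sym2.eq_swap, Sym2.congr_left] at h
    exact hu'.2 (h ▸ hw)

/-- Going back and forth `h` times along an edge. -/
lemma exists_bouncing_walk {κ : Type*} [DecidableEq κ] {R : SimpleGraph κ} {x y : κ}
    (hxy : R.Adj x y) (h : ℕ) :
    ∃ w : R.Walk x x, w.length = 2 * h ∧
      ∀ p, w.support.tail.count p ≤ h * ((if p = x then 1 else 0) + if p = y then 1 else 0) := by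
  induction h with
  | zero => exact ⟨.nil, by simp, by simp⟩
  | succ h ih =>
    obtain ⟨w, hw, hc⟩ := ih
    refine ⟨.cons hxy (.cons hxy.symm w), by simp [hw]; ring, fun p => ?_⟩
    have := hc p
    simp only [SimpleGraph.Walk.support_cons, List.tail_cons, List.count_cons]
    rw [← w.cons_tail_support, List.count_cons]
    have e1 : (if (x == p) = true then 1 else 0) = if p = x then 1 else 0 := by
      simp only [beq_iff_eq, eq_comm (a := p)]
    have e2 : (if (y == p) = true then 1 else 0) = if p = y then 1 else 0 := by
      simp only [beq_iff_eq, eq_comm (a := p)]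
    rw [e1, e2]
    linarith

/-- Closed walks of any prescribed even length in a range, which visit no vertex much more
often than `H` times for each incidence with the matching `x ↦ σ x`. -/
lemma exists_closed_walk {κ : Type*} [Fintype κ] [DecidableEq κ] {R : SimpleGraph κ} (r : κ)
    (σ : κ → κ) (H : ℕ) (X : Finset κ) (hσ : Set.InjOn σ X) (hX : ∀ x ∈ X, R.Adj x (σ x))
    (hr : ∀ x ∈ X, R.Reachable r x) :
    ∃ D ≤ X.card * Fintype.card κ, ∀ h ≤ X.card * H, ∃ w : R.Walk r r,
      w.length = 2 * (h + D) ∧ ∀ p, w.support.count p ≤ 1 + 2 * X.card +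
        H * ((if p ∈ X then 1 else 0) + if p ∈ X.image σ then 1 else 0) := by
  induction X using Finset.induction_on with
  | empty =>
    refine ⟨0, by simp, fun h hh => ⟨.nil, by simp at hh; simp [hh], fun p => ?_⟩⟩
    simp [List.count_singleton]
    split_ifs <;> omega
  | insert x X hx ih =>
    obtain ⟨D, hD, hw⟩ := ih (hσ.mono (by simp)) (fun y hy => hX y (by simp [hy]))
      (fun y hy => hr y (by simp [hy]))
    obtain ⟨π, hπ⟩ := (hr x (by simp)).exists_isPath
    have hxσ : σ x ∉ X.image σ := by
      intro hmem
      obtain ⟨y, hy, hyx⟩ := Finset.mem_image.1 hmem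
      exact hx (hσ (by simp [hy]) (by simp) hyx ▸ hy)
    have hlt := hπ.length_lt
    rw [Finset.card_insert_of_notMem hx]
    refine ⟨D + π.length, by nlinarith, fun h hh => ?_⟩
    obtain ⟨w, hwl, hwc⟩ := hw (min h (X.card * H)) (min_le_right _ _)
    obtain ⟨b, hbl, hbc⟩ := exists_bouncing_walk (hX x (by simp)) (h - X.card * H)
    refine ⟨w.append (π.append (b.append π.reverse)), ?_, fun p => ?_⟩
    · simp only [SimpleGraph.Walk.length_append, SimpleGraph.Walk.length_reverse, hwl, hbl]
      omega
    · have h1 := hwc p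
      have h2 := hbc p
      have h3 : π.support.tail.count p ≤ 1 :=
        ((List.tail_sublist _).count_le _).trans (List.nodup_iff_count_le_one.1 hπ.support_nodup p)
      have h4 : π.reverse.support.tail.count p ≤ 1 :=
        ((List.tail_sublist _).count_le _).trans
          (List.nodup_iff_count_le_one.1 hπ.reverse.support_nodup p)
      have h5 : h - X.card * H ≤ H := by
        rw [add_mul] at hh; omega
      have h6 := Nat.mul_le_mul_right
        ((if p = x then 1 else 0) + if p = σ x then 1 else 0) h5
      have h7 : (if p ∈ insert x X then 1 else 0) = (if p = x then 1 else 0) +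
          if p ∈ X then 1 else 0 := by
        by_cases hp : p = x
        · subst hp; simp [hx]
        · simp [hp]
      have h8 : (if p ∈ (insert x X).image σ then 1 else 0) = (if p = σ x then 1 else 0) +
          if p ∈ X.image σ then 1 else 0 := by
        rw [Finset.image_insert]
        by_cases hp : p = σ x
        · subst hp; simp only [hxσ]; simp
        · simp only [Finset.mem_insert, hp, false_or]; simp
      rw [h7, h8]
      rw [SimpleGraph.Walk.support_append, List.count_append, SimpleGraph.Walk.tail_support_append,
        List.count_append, SimpleGraph.Walk.tail_support_append, List.count_append]
      have h9 := h2.trans h6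
      simp only [mul_add] at *
      omega

/-- König's theorem: a matching and a vertex cover of the same size. -/
lemma exists_matching_and_cover {κ : Type*} [Fintype κ] [DecidableEq κ] (r : κ → κ → Prop) :
    ∃ (X P Q : Finset κ) (σ : κ → κ), Set.InjOn σ X ∧ (∀ x ∈ X, r x (σ x)) ∧
      (∀ x y, r x y → x ∈ P ∨ y ∈ Q) ∧ P.card + Q.card ≤ X.card := by
  classical
  let N : κ → Finset κ := fun x => Finset.univ.filter (r x)
  obtain ⟨S, -, hS⟩ := Finset.exists_max_image (Finset.univ : Finset (Finset κ))
    (fun S => (S.card : ℤ) - (S.biUnion N).card) Finset.univ_nonempty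
  have h0 := hS ∅ (Finset.mem_univ _)
  simp only [Finset.card_empty, Finset.biUnion_empty] at h0
  have hS' : ∀ s : Finset κ, (s.card : ℤ) - (s.biUnion N).card ≤ S.card - (S.biUnion N).card :=
    fun s => hS s (Finset.mem_univ _)
  obtain ⟨d, hd⟩ : ∃ d, S.card = (S.biUnion N).card + d :=
    Nat.exists_eq_add_of_le (by omega)
  let t : κ → Finset (κ ⊕ Fin d) := fun x => (N x).disjSum Finset.univ
  obtain ⟨f, hf, hft⟩ := (Finset.all_card_le_biUnion_card_iff_exists_injective t).1 (by
    intro s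
    rcases s.eq_empty_or_nonempty with rfl | ⟨x, hx⟩
    · simp
    have h1 : ((s.biUnion N).disjSum (Finset.univ : Finset (Fin d))) ⊆ s.biUnion t := by
      intro z hz
      rw [Finset.mem_disjSum] at hz
      rcases hz with ⟨a, ha, rfl⟩ | ⟨b, -, rfl⟩
      · obtain ⟨y, hy, hya⟩ := Finset.mem_biUnion.1 ha
        exact Finset.mem_biUnion.2 ⟨y, hy, by simpa [t] using hya⟩
      · exact Finset.mem_biUnion.2 ⟨x, hx, by simp [t]⟩
    have h2 := Finset.card_le_card h1
    rw [Finset.card_disjSum, Finset.card_univ, Fintype.card_fin] at h2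
    have := hS' s
    omega)
  let X : Finset κ := Finset.univ.filter fun x => (f x).isLeft
  let σ : κ → κ := fun x => (f x).elim id fun _ => x
  have hX : ∀ x ∈ X, f x = Sum.inl (σ x) := by
    intro x hx
    obtain ⟨y, hy⟩ := Sum.isLeft_iff.1 (Finset.mem_filter.1 hx).2
    simp [σ, hy]
  refine ⟨X, Sᶜ, S.biUnion N, σ, ?_, ?_, ?_, ?_⟩
  · intro x hx y hy hxy
    apply hf
    rw [hX x hx, hX y hy, hxy]
  · intro x hx
    have := hft x
    rw [hX x hx] at this
    simpa [t, N] using this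
  · intro x y hxy
    by_cases hx : x ∈ S
    · exact Or.inr (Finset.mem_biUnion.2 ⟨x, hx, by simpa [N] using hxy⟩)
    · exact Or.inl (by simpa using hx)
  · have h1 : Xᶜ.card ≤ d := by
      rw [← Fintype.card_fin d, ← Finset.card_univ,
        ← Finset.card_map (Function.Embedding.inr : Fin d ↪ κ ⊕ Fin d)]
      refine Finset.card_le_card_of_injOn f ?_ hf.injOn
      intro x hx
      have : ¬ (f x).isLeft := by simpa [X] using hx
      rw [Sum.not_isLeft, Sum.isRight_iff] at this
      obtain ⟨y, hy⟩ := this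
      simp [hy]
    rw [Finset.card_compl] at h1 ⊢
    have := S.card_le_univ
    have := X.card_le_univ
    omega

/-- Each component of the reduced graph either carries a matching that yields a long cycle,
or its edges are covered by weights of small total. -/
lemma exists_cycle_or_component_weights {V κ : Type*} [DecidableEq V] [Fintype κ] [DecidableEq κ]
    {G : SimpleGraph V}
    [DecidableRel G.Adj] {R : SimpleGraph κ} [DecidableEq R.ConnectedComponent]
    {cell : κ → Finset V} {e β H m : ℕ}
    (hdisj : ∀ a b, a ≠ b → Disjoint (cell a) (cell b))
    (hR : ∀ a b, R.Adj a b → ∀ U ⊆ cell a, ∀ Y ⊆ cell b, e ≤ U.card → β ≤ Y.card →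
      ∃ u ∈ U, 2 * e ≤ (Y.filter (G.Adj u)).card)
    (hR' : ∀ a b, R.Adj a b → ∀ U ⊆ cell a, ∀ Y ⊆ cell b, e ≤ U.card → e ≤ Y.card →
      ∃ u ∈ U, ∃ w ∈ Y, G.Adj u w)
    (hm : Fintype.card κ ^ 2 + 2 ≤ m)
    (hcell : ∀ p, 2 * H + 2 * Fintype.card κ + 3 + e + β ≤ (cell p).card) :
    (∃ (v : V) (w : G.Walk v v), w.IsCycle ∧ w.length = 2 * m) ∨
    ∃ t : κ → ℕ, (∀ p q, R.Adj p q → 2 ≤ t p + t q) ∧ (∀ p, t p ≤ 2) ∧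
      ∀ C : R.ConnectedComponent, (∑ p with R.connectedComponentMk p = C, t p) * H < m := by
  classical
  by_cases hcyc : ∃ (v : V) (w : G.Walk v v), w.IsCycle ∧ w.length = 2 * m
  · exact Or.inl hcyc
  refine Or.inr ?_
  choose X P Q σ hσ hX hPQ hcard using fun C : R.ConnectedComponent =>
    exists_matching_and_cover fun p q => R.Adj p q ∧ R.connectedComponentMk p = C
  have hsmall : ∀ C, (X C).card * H < m := by
    intro C
    by_contra! hC
    apply hcyc
    have hne : (X C).Nonempty := by
      rw [← Finset.card_pos]
      by_contra h0
      have : (X C).card = 0 := by omega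
      rw [this] at hC; omega
    obtain ⟨r, hr⟩ := hne
    obtain ⟨D, hD, hw⟩ := exists_closed_walk (R := R) r (σ C) H (X C) (hσ C)
      (fun x hx => (hX C x hx).1)
      (fun x hx => SimpleGraph.ConnectedComponent.exact
        ((hX C r hr).2.trans (hX C x hx).2.symm))
    have hXκ := (X C).card_le_univ
    have hDm : D + 2 ≤ m := by nlinarith
    obtain ⟨w, hwl, hwc⟩ := hw (m - 2 - D) (by omega)
    have hadj := (hX C r hr).1
    obtain ⟨v, c, hc, hcl⟩ := exists_cycle_along_walk hdisj hR hR' hadj (.cons hadj.symm w) (by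
      intro p
      have h1 := hwc p
      have h2 := hcell p
      have h3 : H * ((if p ∈ X C then 1 else 0) + if p ∈ (X C).image (σ C) then 1 else 0)
          ≤ H * 2 := Nat.mul_le_mul_left _ (by split_ifs <;> omega)
      rw [SimpleGraph.Walk.support_cons, List.count_cons]
      have h4 : (if (σ C r == p) = true then 1 else 0) ≤ 1 := by split_ifs <;> omega
      omega)
    refine ⟨v, c, hc, ?_⟩
    rw [hcl, SimpleGraph.Walk.length_cons, hwl]
    omega
  let t : κ → ℕ := fun p => (if p ∈ P (R.connectedComponentMk p) then 1 else 0) +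
    if p ∈ Q (R.connectedComponentMk p) then 1 else 0
  refine ⟨t, ?_, ?_, ?_⟩
  · intro p q hpq
    have hc : R.connectedComponentMk q = R.connectedComponentMk p :=
      SimpleGraph.ConnectedComponent.sound hpq.symm.reachable
    have h1 := hPQ _ p q ⟨hpq, rfl⟩
    have h2 := hPQ _ q p ⟨hpq.symm, hc⟩
    simp only [t, hc]
    grind
  · intro p
    simp only [t]
    split_ifs <;> omega
  · intro C
    refine lt_of_le_of_lt (Nat.mul_le_mul_right _ (le_trans ?_ (hcard C))) (hsmall C)
    calc ∑ p with R.connectedComponentMk p = C, t p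
        = ∑ p with R.connectedComponentMk p = C, ((if p ∈ P C then 1 else 0) +
          if p ∈ Q C then 1 else 0) := Finset.sum_congr rfl fun p hp => by
            simp only [t, (Finset.mem_filter.1 hp).2]
      _ ≤ ∑ p, ((if p ∈ P C then 1 else 0) + if p ∈ Q C then 1 else 0) :=
          Finset.sum_le_sum_of_subset (Finset.filter_subset _ _)
      _ = (P C).card + (Q C).card := by
          rw [Finset.sum_add_distrib]; simp

lemma exists_large_degree_of_isUniform {V : Type*} [DecidableEq V] {G : SimpleGraph V}
    [DecidableRel G.Adj] {ε d : ℝ} {A B U Y : Finset V} (h : G.IsUniform ε A B)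
    (hd : d ≤ G.edgeDensity A B) (hU : U ⊆ A) (hY : Y ⊆ B) (hUA : (A.card : ℝ) * ε ≤ U.card)
    (hYB : (B.card : ℝ) * ε ≤ Y.card) (hU0 : U.Nonempty) :
    ∃ u ∈ U, (d - ε) * Y.card ≤ (Y.filter (G.Adj u)).card := by
  by_contra! hlt
  have h1 := abs_lt.1 (h hU hY hUA hYB)
  have h2 : (d - ε) ≤ (G.edgeDensity U Y : ℝ) := by linarith
  have hcard : (G.interedges U Y).card = ∑ u ∈ U, (Y.filter (G.Adj u)).card := by
    rw [SimpleGraph.interedges, Rel.interedges, Finset.card_filter, Finset.sum_product]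
    exact Finset.sum_congr rfl fun u _ => (Finset.card_filter _ _).symm
  have h3 : ((G.interedges U Y).card : ℝ) < U.card * ((d - ε) * Y.card) := by
    rw [hcard]; push_cast
    calc _ < ∑ u ∈ U, (d - ε) * (Y.card : ℝ) := Finset.sum_lt_sum_of_nonempty hU0 hlt
      _ = _ := by simp
  obtain ⟨u, hu⟩ := hU0
  have hUp : (0 : ℝ) < U.card := by exact_mod_cast Finset.card_pos.2 ⟨u, hu⟩
  have hYp : (0 : ℝ) < Y.card := by
    rcases Y.eq_empty_or_nonempty with rfl | hY
    · simp only [Finset.card_empty, Nat.cast_zero, mul_zero] at h3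
      exact absurd h3 (not_lt.2 (by positivity))
    · exact_mod_cast Finset.card_pos.2 hY
  have h4 : (G.edgeDensity U Y : ℝ) = (G.interedges U Y).card / (U.card * Y.card) := by
    simp [SimpleGraph.edgeDensity_def]
  rw [h4, le_div_iff₀ (by positivity)] at h2
  linarith

/-- The number of ordered adjacent pairs which do not run between the two parts of a regular pair
of positive density. -/
lemma card_unreduced_le {V : Type*} [Fintype V] [DecidableEq V] [Nonempty V] {G : SimpleGraph V}
    [DecidableRel G.Adj] {P : Finpartition (Finset.univ : Finset V)} {ε d ε₂ : ℝ} (hε : 0 < ε)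
    (hd : 0 < d) (hε₂ : 0 < ε₂) (hP : P.IsEquipartition) (hPu : P.IsUniform G ε)
    (hl : 4 / ε₂ ≤ P.parts.card) (E : Finset (V × V))
    (hE : ∀ x ∈ E, G.Adj x.1 x.2 ∧ ∀ A ∈ P.parts, ∀ B ∈ P.parts, x.1 ∈ A → x.2 ∈ B → A ≠ B →
      ¬ (G.IsUniform ε A B ∧ d ≤ G.edgeDensity A B)) :
    (E.card : ℝ) ≤ (4 * ε + ε₂ / 2 + 4 * d) * (Fintype.card V : ℝ) ^ 2 := by
  classical
  let A := (P.nonUniforms G ε).biUnion fun (U, V) ↦ U ×ˢ V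
  let B := P.parts.biUnion Finset.offDiag
  let C := (P.sparsePairs G d).biUnion fun (U, V) ↦ G.interedges U V
  have hsub : E ⊆ A ∪ B ∪ C := by
    rintro ⟨x, y⟩ hxy
    obtain ⟨hadj, h⟩ := hE _ hxy
    obtain ⟨U, hU, hx⟩ := P.exists_mem (Finset.mem_univ x)
    obtain ⟨W, hW, hy⟩ := P.exists_mem (Finset.mem_univ y)
    simp only [A, B, C, Finset.mem_union, Finset.mem_biUnion, Finset.mem_product, Prod.exists,
      Finset.mem_offDiag, P.mk_mem_nonUniforms, Finpartition.mk_mem_sparsePairs,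
      SimpleGraph.mem_interedges_iff]
    by_cases hUW : U = W
    · subst hUW
      exact Or.inl (Or.inr ⟨U, hU, hx, hy, hadj.ne⟩)
    have := h U hU W hW hx hy hUW
    by_cases hu : G.IsUniform ε U W
    · refine Or.inr ⟨U, W, ⟨hU, hW, hUW, ?_⟩, hx, hy, hadj⟩
      exact lt_of_not_ge fun hge => this ⟨hu, hge⟩
    · exact Or.inl (Or.inl ⟨U, W, ⟨hU, hW, hUW, hu⟩, hx, hy⟩)
  have hA : (A.card : ℝ) < 4 * ε * (Fintype.card V : ℝ) ^ 2 :=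
    hP.sum_nonUniforms_lt Finset.univ_nonempty hε hPu
  have hB : (B.card : ℝ) ≤ ε₂ / 2 * (Fintype.card V : ℝ) ^ 2 :=
    hP.card_biUnion_offDiag_le hε₂ hl
  have hC : (C.card : ℝ) ≤ 4 * d * (Fintype.card V : ℝ) ^ 2 :=
    hP.card_interedges_sparsePairs_le hd.le
  have h1 : (E.card : ℝ) ≤ A.card + B.card + C.card := by
    have h2 := Finset.card_le_card hsub
    have h3 := Finset.card_union_le (A ∪ B) C
    have h4 := Finset.card_union_le A B
    exact_mod_cast (by omega : E.card ≤ A.card + B.card + C.card)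
  linarith

lemma sum_classWeight_comp_le {V κ ι : Type*} [Fintype V] [Fintype κ] [DecidableEq κ]
    [DecidableEq ι] (f : V → κ) (c : κ → ι) (t : κ → ℕ) {b : ℕ}
    (hf : ∀ p, (Finset.univ.filter fun v => f v = p).card ≤ b) (x : ι) :
    ∑ v, classWeight (c ∘ f) (t ∘ f) x v ≤ b * ∑ p with c p = x, t p := by
  calc ∑ v, classWeight (c ∘ f) (t ∘ f) x v
      = ∑ p, ∑ v with f v = p, classWeight (c ∘ f) (t ∘ f) x v :=
        (Finset.sum_fiberwise _ _ _).symm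
    _ ≤ ∑ p, b * if c p = x then t p else 0 := by
        refine Finset.sum_le_sum fun p _ => ?_
        calc ∑ v with f v = p, classWeight (c ∘ f) (t ∘ f) x v
            = ∑ v with f v = p, if c p = x then t p else 0 := by
              refine Finset.sum_congr rfl fun v hv => ?_
              simp [classWeight, (Finset.mem_filter.1 hv).2]
          _ = (Finset.univ.filter fun v => f v = p).card * if c p = x then t p else 0 := by simp
          _ ≤ _ := Nat.mul_le_mul_right _ (hf p)
    _ = _ := by rw [← Finset.mul_sum, Finset.sum_filter]

set_option maxHeartbeats 1600000 in
/-- A graph on `N` vertices without a cycle of length `2 * m` admits a partition of its vertices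
into classes, and weights in `{0, 1, 2}` whose sum over each class is at most about `2 * m`, which
cover all but few edges. -/
theorem exists_cycle_or_weights {ε : ℝ} (hε : 0 < ε) (hε1 : ε ≤ 1) :
    ∃ N₀ : ℕ, ∀ N ≥ N₀, ∀ (G : SimpleGraph (Fin N)) (m : ℕ), ε * N ≤ m →
      (∃ (v : Fin N) (w : G.Walk v v), w.IsCycle ∧ w.length = 2 * m) ∨
      ∃ (ι : Type) (c : Fin N → ι) (t : Fin N → ℕ), (∀ v, t v ≤ 2) ∧
        (∀ x, ∑ v, (classWeight c t x v : ℝ) ≤ (2 + ε) * m) ∧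
        ∀ E : Finset (Fin N × Fin N), (∀ x ∈ E, G.Adj x.1 x.2 ∧ ¬ Covers c t x.1 x.2) →
          (E.card : ℝ) ≤ ε * N ^ 2 := by
  classical
  obtain ⟨η, hη⟩ : ∃ η : ℝ, η = ε / 18 := ⟨_, rfl⟩
  obtain ⟨d, hd⟩ : ∃ d : ℝ, d = ε / 16 := ⟨_, rfl⟩
  obtain ⟨ρ, hρ⟩ : ∃ ρ : ℝ, ρ = d * η / 8 := ⟨_, rfl⟩
  have hη0 : 0 < η := by rw [hη]; positivity
  have hd0 : 0 < d := by rw [hd]; positivity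
  have hρ0 : 0 < ρ := by rw [hρ]; positivity
  have hρη : ρ ≤ η / 8 := by rw [hρ]; nlinarith
  have hρd : ρ ≤ d / 8 := by rw [hρ]; nlinarith
  obtain ⟨l, hl⟩ : ∃ l : ℕ, l = ⌈4 / (ε / 2)⌉₊ := ⟨_, rfl⟩
  obtain ⟨K, hK⟩ : ∃ K : ℕ, K = SzemerediRegularity.bound ρ l := ⟨_, rfl⟩
  obtain ⟨L₀, hL₀⟩ : ∃ L₀ : ℕ, L₀ = ⌈(2 * K + 10) / ρ⌉₊ := ⟨_, rfl⟩
  obtain ⟨J, hJ⟩ : ∃ J : ℕ, J = ⌈((K : ℝ) ^ 2 + 2) / ε⌉₊ := ⟨_, rfl⟩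
  refine ⟨K * L₀ + J + l + 1, fun N hN G m hm => ?_⟩
  have hN0 : 0 < N := by omega
  have : Nonempty (Fin N) := ⟨⟨0, hN0⟩⟩
  obtain ⟨P, hPe, hPl, hPK, hPu⟩ := szemeredi_regularity G hρ0
    (l := l) (by rw [Fintype.card_fin]; omega)
  rw [← hK] at hPK
  have hl0 : (4 : ℝ) / (ε / 2) ≤ l := by rw [hl]; exact Nat.le_ceil _
  have hparts : 0 < P.parts.card := by
    have : (0 : ℝ) < l := lt_of_lt_of_le (by positivity) hl0
    have : 0 < l := by exact_mod_cast this
    omega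
  obtain ⟨L, hL⟩ : ∃ L : ℕ, L = N / P.parts.card := ⟨_, rfl⟩
  have hLL₀ : L₀ ≤ L := by
    rw [hL, Nat.le_div_iff_mul_le hparts]
    calc L₀ * P.parts.card ≤ L₀ * K := Nat.mul_le_mul_left _ hPK
      _ = K * L₀ := mul_comm _ _
      _ ≤ N := by omega
  have hLρ : 2 * (K : ℝ) + 10 ≤ ρ * L := by
    have h1 : (2 * (K : ℝ) + 10) / ρ ≤ L₀ := by rw [hL₀]; exact Nat.le_ceil _
    have h2 : (L₀ : ℝ) ≤ L := by exact_mod_cast hLL₀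
    rw [← div_le_iff₀' hρ0]; linarith
  have hsize : ∀ A ∈ P.parts, L ≤ A.card ∧ A.card ≤ L + 1 := by
    intro A hA
    have := hPe.card_parts_eq_average hA
    rw [Finset.card_univ, Fintype.card_fin, ← hL] at this
    omega
  have hsizeR : ∀ A ∈ P.parts, (A.card : ℝ) ≤ L + 1 := fun A hA => by
    exact_mod_cast (hsize A hA).2
  obtain ⟨e, he⟩ : ∃ e : ℕ, e = ⌈ρ * (L + 1)⌉₊ := ⟨_, rfl⟩
  obtain ⟨β, hβ⟩ : ∃ β : ℕ, β = ⌈η * L⌉₊ := ⟨_, rfl⟩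
  have he1 : ρ * (L + 1) ≤ e := by rw [he]; exact Nat.le_ceil _
  have he2 : (e : ℝ) < ρ * (L + 1) + 1 := by rw [he]; exact Nat.ceil_lt_add_one (by positivity)
  have hβ1 : η * L ≤ β := by rw [hβ]; exact Nat.le_ceil _
  have hβ2 : (β : ℝ) < η * L + 1 := by rw [hβ]; exact Nat.ceil_lt_add_one (by positivity)
  have hK0 : (0 : ℝ) ≤ K := by positivity
  have hρ1 : ρ ≤ 1 := by linarith
  have hρL : ρ * L ≤ η / 8 * L := by gcongr
  have heβ : e ≤ β := by
    have : (e : ℝ) ≤ β := by nlinarith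
    exact_mod_cast this
  have he0 : 0 < e := by
    have : (0 : ℝ) < e := lt_of_lt_of_le (by positivity) he1
    exact_mod_cast this
  let κ := {A : Finset (Fin N) // A ∈ P.parts}
  have hκ : Fintype.card κ = P.parts.card := by simp [κ]
  let R : SimpleGraph κ :=
    { Adj := fun a b => a ≠ b ∧ G.IsUniform ρ a.1 b.1 ∧ d ≤ G.edgeDensity a.1 b.1
      symm.symm := fun a b h => ⟨h.1.symm, h.2.1.symm, by
        rw [SimpleGraph.edgeDensity_comm]; exact h.2.2⟩
      loopless.irrefl := fun a h => h.1 rfl }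
  obtain ⟨H, hH⟩ : ∃ H : ℕ, H = (L - (2 * P.parts.card + 3 + e + β)) / 2 := ⟨_, rfl⟩
  have hPKR : (P.parts.card : ℝ) ≤ K := by exact_mod_cast hPK
  have hLbig : 2 * P.parts.card + 3 + e + β ≤ L := by
    have : (2 * P.parts.card + 3 + e + β : ℝ) ≤ L := by nlinarith
    exact_mod_cast this
  have hHL : (L + 1 : ℝ) ≤ (2 + ε) * H := by
    have h1 : L ≤ 2 * H + 1 + (2 * P.parts.card + 3 + e + β) := by omega
    have h2 : (L : ℝ) ≤ 2 * H + 1 + (2 * P.parts.card + 3 + e + β) := by exact_mod_cast h1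
    have h3 : (1 - 3 * η) * L ≤ 2 * H := by nlinarith
    have h4 : (1 + ε / 2) * ((1 - 3 * η) * L) ≤ (1 + ε / 2) * (2 * H) := by gcongr
    have h5 : (1 + ε / 4) * L ≤ (1 + ε / 2) * ((1 - 3 * η) * L) := by
      rw [hη]; nlinarith [mul_nonneg (mul_nonneg hε.le (sub_nonneg.2 hε1)) (Nat.cast_nonneg (α := ℝ) L)]
    nlinarith
  refine (exists_cycle_or_component_weights (G := G) (R := R) (cell := fun a : κ => a.1) (e := e)
    (β := β) (H := H) (m := m) ?_ ?_ ?_ ?_ ?_).imp id ?_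
  · intro a b hab
    exact P.disjoint a.2 b.2 fun h => hab (Subtype.ext h)
  · intro a b hab U hU Y hY hUe hYβ
    have hUe' : (e : ℝ) ≤ U.card := by exact_mod_cast hUe
    have hYβ' : (β : ℝ) ≤ Y.card := by exact_mod_cast hYβ
    have ha := hsizeR a.1 a.2
    have hb := hsizeR b.1 b.2
    obtain ⟨u, hu, hdeg⟩ := exists_large_degree_of_isUniform hab.2.1 hab.2.2 hU hY
      (by nlinarith) (by nlinarith) (Finset.card_pos.1 (by omega))
    refine ⟨u, hu, ?_⟩
    have h1 : d / 2 * (η * L) ≤ (d - ρ) * Y.card :=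
      mul_le_mul (by linarith) (by linarith) (by positivity) (by linarith)
    have h2 : d / 2 * (η * L) = 4 * (ρ * L) := by rw [hρ]; ring
    have h3 : (2 * e : ℝ) ≤ (Y.filter (G.Adj u)).card := by nlinarith
    exact_mod_cast h3
  · intro a b hab U hU Y hY hUe hYe
    have hUe' : (e : ℝ) ≤ U.card := by exact_mod_cast hUe
    have hYe' : (e : ℝ) ≤ Y.card := by exact_mod_cast hYe
    have ha := hsizeR a.1 a.2
    have hb := hsizeR b.1 b.2
    obtain ⟨u, hu, hdeg⟩ := exists_large_degree_of_isUniform hab.2.1 hab.2.2 hU hY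
      (by nlinarith) (by nlinarith) (Finset.card_pos.1 (by omega))
    have he0' : (0 : ℝ) < e := by exact_mod_cast he0
    have h1 : (0 : ℝ) < (Y.filter (G.Adj u)).card :=
      lt_of_lt_of_le (mul_pos (by linarith) (by linarith)) hdeg
    obtain ⟨w, hw⟩ := Finset.card_pos.1 (by exact_mod_cast h1)
    exact ⟨u, hu, w, (Finset.mem_filter.1 hw).1, (Finset.mem_filter.1 hw).2⟩
  · rw [hκ]
    have h0 : J ≤ N := by omega
    have h1 : ((K : ℝ) ^ 2 + 2) / ε ≤ N := by
      refine le_trans ?_ (Nat.cast_le.2 h0)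
      rw [hJ]
      exact Nat.le_ceil _
    rw [div_le_iff₀' hε] at h1
    have h2 : (P.parts.card : ℝ) ^ 2 ≤ K ^ 2 := by gcongr
    have h3 : ((P.parts.card ^ 2 + 2 : ℕ) : ℝ) ≤ m := by push_cast; linarith
    exact_mod_cast h3
  · intro p
    rw [hκ]
    have := (hsize p.1 p.2).1
    omega
  · rintro ⟨t, ht, ht2, htc⟩
    let f : Fin N → κ := fun v => ⟨P.part v, P.part_mem.2 (Finset.mem_univ v)⟩
    refine ⟨R.ConnectedComponent, R.connectedComponentMk ∘ f, t ∘ f, fun v => ht2 _,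
      fun x => ?_, fun E hE => ?_⟩
    · have h1 := sum_classWeight_comp_le f R.connectedComponentMk t (b := L + 1) (fun p => by
        refine le_trans (Finset.card_le_card ?_) (hsize p.1 p.2).2
        intro v hv
        have : f v = p := (Finset.mem_filter.1 hv).2
        rw [← this]
        exact P.mem_part (Finset.mem_univ v)) x
      have h2 := htc x
      have h3 : ((∑ v, classWeight (R.connectedComponentMk ∘ f) (t ∘ f) x v : ℕ) : ℝ) ≤
          (L + 1) * (∑ p with R.connectedComponentMk p = x, t p : ℕ) := by exact_mod_cast h1
      have h4 : ((∑ p with R.connectedComponentMk p = x, t p : ℕ) : ℝ) * H ≤ m := by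
        exact_mod_cast h2.le
      rw [← Nat.cast_sum]
      refine h3.trans ?_
      calc _ ≤ ((2 + ε) * H) * ((∑ p with R.connectedComponentMk p = x, t p : ℕ) : ℝ) := by gcongr
        _ = (2 + ε) * (((∑ p with R.connectedComponentMk p = x, t p : ℕ) : ℝ) * H) := by ring
        _ ≤ _ := by gcongr
    · have h1 := card_unreduced_le (G := G) hρ0 hd0 (ε₂ := ε / 2) (by positivity) hPe hPu
        (hl0.trans (by exact_mod_cast hPl)) E (by
          intro x hx
          obtain ⟨hadj, hcov⟩ := hE x hx
          refine ⟨hadj, fun A hA B hB hxA hxB hAB hreg => hcov ?_⟩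
          have hfA : f x.1 = ⟨A, hA⟩ := Subtype.ext (P.part_eq_of_mem hA hxA)
          have hfB : f x.2 = ⟨B, hB⟩ := Subtype.ext (P.part_eq_of_mem hB hxB)
          have hR : R.Adj ⟨A, hA⟩ ⟨B, hB⟩ := ⟨fun h => hAB (congrArg Subtype.val h), hreg⟩
          refine ⟨?_, ?_⟩
          · simp only [Function.comp, hfA, hfB]
            exact SimpleGraph.ConnectedComponent.sound hR.reachable
          · simp only [Function.comp, hfA, hfB]
            exact ht _ _ hR)
      rw [Fintype.card_fin] at h1
      refine h1.trans ?_
      gcongr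
      rw [hd] at hρd ⊢
      linarith

open Classical in
lemma sum_simpleGraph_eq_sum_powerset (N : ℕ) (f : Finset (Sym2 (Fin N)) → ℝ) :
    ∑ G : SimpleGraph (Fin N), f G.edgeFinset =
      ∑ A ∈ (⊤ : SimpleGraph (Fin N)).edgeFinset.powerset, f A := by
  refine Finset.sum_bij (fun G _ => G.edgeFinset) (fun G _ => ?_) (fun G _ G' _ h => ?_)
    (fun A hA => ?_) (fun _ _ => rfl)
  · exact Finset.mem_powerset.2 (SimpleGraph.edgeFinset_mono le_top)
  · exact SimpleGraph.edgeFinset_inj.1 h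
  · obtain ⟨G, hG⟩ : ∃ G : SimpleGraph (Fin N), G.edgeSet = A := by
      refine ⟨SimpleGraph.fromEdgeSet A, ?_⟩
      rw [SimpleGraph.edgeSet_fromEdgeSet]
      refine Set.Subset.antisymm Set.sdiff_subset fun e h => ⟨h, fun hd => ?_⟩
      have := Finset.mem_powerset.1 hA h
      rw [SimpleGraph.mem_edgeFinset] at this
      exact SimpleGraph.not_isDiag_of_mem_edgeSet _ this hd
    refine ⟨G, Finset.mem_univ _, Finset.coe_injective ?_⟩
    rw [SimpleGraph.coe_edgeFinset, hG]

open Classical in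
lemma sum_weight_mul_half_pow (N : ℕ) (p : ℝ) (F : Finset (Sym2 (Fin N)))
    (hF : F ⊆ (⊤ : SimpleGraph (Fin N)).edgeFinset) :
    ∑ G : SimpleGraph (Fin N), p ^ (Nat.card G.edgeSet) *
      (1 - p) ^ (N.choose 2 - Nat.card G.edgeSet) * (1 / 2) ^ (G.edgeFinset ∩ F).card =
      (1 - p / 2) ^ F.card := by
  set D := (⊤ : SimpleGraph (Fin N)).edgeFinset with hD
  have hDc : D.card = N.choose 2 := by
    rw [hD, SimpleGraph.card_edgeFinset_top_eq_card_choose_two, Fintype.card_fin]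
  have h1 := Finset.prod_add (fun e => p * if e ∈ F then (1 / 2 : ℝ) else 1)
    (fun _ => 1 - p) D
  have h2 : ∏ e ∈ D, ((p * if e ∈ F then (1 / 2 : ℝ) else 1) + (1 - p)) =
      (1 - p / 2) ^ F.card := by
    rw [← Finset.prod_sdiff hF, Finset.prod_eq_one, one_mul, Finset.prod_eq_pow_card]
    · intro e he
      rw [if_pos he]; ring
    · intro e he
      rw [if_neg (Finset.mem_sdiff.1 he).2]; ring
  rw [← h2, h1, ← sum_simpleGraph_eq_sum_powerset]
  refine Finset.sum_congr rfl fun G _ => ?_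
  have hG : G.edgeFinset ⊆ D := SimpleGraph.edgeFinset_mono le_top
  rw [Finset.prod_mul_distrib, Finset.prod_const, Finset.prod_const, Finset.card_sdiff_of_subset hG,
    hDc, Finset.prod_ite, Finset.prod_const, Finset.prod_const, one_pow, mul_one,
    Finset.filter_mem_eq_inter, Nat.card_eq_fintype_card, ← SimpleGraph.edgeFinset_card]
  ring

lemma weight_nonneg {p : ℝ} (hp0 : 0 ≤ p) (hp1 : p ≤ 1) (a b : ℕ) :
    0 ≤ p ^ a * (1 - p) ^ b :=
  mul_nonneg (pow_nonneg hp0 _) (pow_nonneg (by linarith) _)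

lemma graphProbability_mono {N : ℕ} {p : ℝ} (hp0 : 0 ≤ p) (hp1 : p ≤ 1)
    {E E' : Set (SimpleGraph (Fin N))} (h : E ⊆ E') :
    graphProbability N p E ≤ graphProbability N p E' := by
  classical
  refine Finset.sum_le_sum fun G _ => ?_
  have := weight_nonneg hp0 hp1 (Nat.card G.edgeSet) (N.choose 2 - Nat.card G.edgeSet)
  by_cases hG : G ∈ E
  · rw [if_pos hG, if_pos (h hG)]
  · rw [if_neg hG]
    split_ifs
    exacts [this, le_rfl]

lemma graphProbability_univ (N : ℕ) (p : ℝ) : graphProbability N p Set.univ = 1 := by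
  classical
  have := sum_weight_mul_half_pow N p ∅ (Finset.empty_subset _)
  simpa [graphProbability] using this

lemma graphProbability_add_compl (N : ℕ) (p : ℝ) (E : Set (SimpleGraph (Fin N))) :
    graphProbability N p E + graphProbability N p Eᶜ = 1 := by
  classical
  rw [← graphProbability_univ N p, graphProbability, graphProbability, graphProbability,
    ← Finset.sum_add_distrib]
  refine Finset.sum_congr rfl fun G _ => ?_
  by_cases hG : G ∈ E <;> simp [hG]

lemma graphProbability_exists_le {N : ℕ} {p : ℝ} (hp0 : 0 ≤ p) (hp1 : p ≤ 1) {κ : Type*}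
    [Fintype κ] (E : κ → Set (SimpleGraph (Fin N))) :
    graphProbability N p {G | ∃ k, G ∈ E k} ≤ ∑ k, graphProbability N p (E k) := by
  classical
  simp only [graphProbability]
  rw [Finset.sum_comm]
  refine Finset.sum_le_sum fun G _ => ?_
  have hw := weight_nonneg hp0 hp1 (Nat.card G.edgeSet) (N.choose 2 - Nat.card G.edgeSet)
  have hn : ∀ k ∈ Finset.univ, 0 ≤ if G ∈ E k then p ^ (Nat.card G.edgeSet) *
      (1 - p) ^ (N.choose 2 - Nat.card G.edgeSet) else 0 := fun k _ => by
    split_ifs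
    exacts [hw, le_rfl]
  split_ifs with h
  · obtain ⟨k, hk⟩ := h
    refine le_trans ?_ (Finset.single_le_sum hn (Finset.mem_univ k))
    rw [if_pos hk]
  · exact Finset.sum_nonneg hn

open Classical in
lemma graphProbability_few_edges_le {N : ℕ} {p : ℝ} (hp0 : 0 ≤ p) (hp1 : p ≤ 1)
    (F : Finset (Sym2 (Fin N))) (hF : F ⊆ (⊤ : SimpleGraph (Fin N)).edgeFinset) (s : ℕ) :
    graphProbability N p {G | (G.edgeFinset ∩ F).card ≤ s} ≤ 2 ^ s * (1 - p / 2) ^ F.card := by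
  rw [← sum_weight_mul_half_pow N p F hF, Finset.mul_sum]
  refine Finset.sum_le_sum fun G _ => ?_
  have hw := weight_nonneg hp0 hp1 (Nat.card G.edgeSet) (N.choose 2 - Nat.card G.edgeSet)
  split_ifs with h
  · have h1 : (1 : ℝ) ≤ 2 ^ s * (1 / 2) ^ (G.edgeFinset ∩ F).card := by
      calc (1 : ℝ) = 2 ^ s * (1 / 2) ^ s := by rw [← mul_pow]; norm_num
        _ ≤ _ := mul_le_mul_of_nonneg_left
          (pow_le_pow_of_le_one (by norm_num) (by norm_num) h) (by positivity)
    calc _ ≤ (p ^ (Nat.card G.edgeSet) * (1 - p) ^ (N.choose 2 - Nat.card G.edgeSet)) *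
          (2 ^ s * (1 / 2) ^ (G.edgeFinset ∩ F).card) := le_mul_of_one_le_right hw h1
      _ = _ := by ring
  · positivity

open Classical in
lemma exists_disjoint_few_edges {N k s : ℕ} {G : SimpleGraph (Fin N)} {X Y : Finset (Fin N)}
    (hX : 2 * k ≤ X.card) (hY : 2 * k ≤ Y.card)
    (h : ((X ×ˢ Y).filter fun x => G.Adj x.1 x.2).card ≤ s) :
    ∃ X' Y' : Finset (Fin N), (Disjoint X' Y' ∧ X'.card = k ∧ Y'.card = k) ∧
      (G.edgeFinset ∩ (X' ×ˢ Y').image fun x => s(x.1, x.2)).card ≤ s := by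
  obtain ⟨X', hX', hXk⟩ := Finset.exists_subset_card_eq (show k ≤ X.card by omega)
  obtain ⟨Y', hY', hYk⟩ := Finset.exists_subset_card_eq (s := Y \ X') (n := k) (by
    have := Finset.le_card_sdiff X' Y
    omega)
  refine ⟨X', Y', ⟨?_, hXk, hYk⟩, le_trans ?_ h⟩
  · exact Finset.disjoint_left.2 fun v hv hv' => (Finset.mem_sdiff.1 (hY' hv')).2 hv
  · refine le_trans (Finset.card_le_card ?_) (Finset.card_image_le (f := fun x => s(x.1, x.2)))
    intro e he
    rw [Finset.mem_inter, Finset.mem_image] at he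
    obtain ⟨he1, ⟨u, v⟩, huv, rfl⟩ := he
    rw [Finset.mem_product] at huv
    rw [SimpleGraph.mem_edgeFinset, SimpleGraph.mem_edgeSet] at he1
    refine Finset.mem_image.2 ⟨(u, v), Finset.mem_filter.2 ⟨Finset.mem_product.2 ⟨hX' huv.1, ?_⟩,
      he1⟩, rfl⟩
    exact (Finset.mem_sdiff.1 (hY' huv.2)).1

open Classical in
lemma graphProbability_sparse_pair_le {N : ℕ} {p : ℝ} (hp0 : 0 ≤ p) (hp1 : p ≤ 1) (k s : ℕ) :
    graphProbability N p {G | ∃ X Y : Finset (Fin N), 2 * k ≤ X.card ∧ 2 * k ≤ Y.card ∧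
      ((X ×ˢ Y).filter fun x => G.Adj x.1 x.2).card ≤ s} ≤
      4 ^ N * (2 ^ s * (1 - p / 2) ^ (k * k)) := by
  let κ := {q : Finset (Fin N) × Finset (Fin N) //
    Disjoint q.1 q.2 ∧ q.1.card = k ∧ q.2.card = k}
  let F : κ → Finset (Sym2 (Fin N)) := fun q => (q.1.1 ×ˢ q.1.2).image fun x => s(x.1, x.2)
  have hF : ∀ q, F q ⊆ (⊤ : SimpleGraph (Fin N)).edgeFinset := by
    intro q e he
    obtain ⟨⟨u, v⟩, huv, rfl⟩ := Finset.mem_image.1 he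
    rw [Finset.mem_product] at huv
    rw [SimpleGraph.mem_edgeFinset, SimpleGraph.mem_edgeSet, SimpleGraph.top_adj]
    rintro h
    exact Finset.disjoint_left.1 q.2.1 huv.1 (by rw [show u = v from h]; exact huv.2)
  have hFc : ∀ q, (F q).card = k * k := by
    intro q
    rw [Finset.card_image_of_injOn, Finset.card_product, q.2.2.1, q.2.2.2]
    rintro ⟨u, v⟩ huv ⟨u', v'⟩ huv' h
    rw [Finset.mem_coe, Finset.mem_product] at huv huv'
    rcases Sym2.eq_iff.1 h with ⟨h1, h2⟩ | ⟨h1, h2⟩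
    · exact Prod.ext h1 h2
    · have h1 : u = v' := h1
      exact absurd huv'.2 (Finset.disjoint_left.1 q.2.1 (by rw [← h1]; exact huv.1))
  have hκ : (Fintype.card κ : ℝ) ≤ 4 ^ N := by
    have h1 : Fintype.card κ ≤ 2 ^ N * 2 ^ N := by
      refine (Fintype.card_subtype_le _).trans ?_
      simp
    have h2 : 2 ^ N * 2 ^ N = 4 ^ N := by rw [← mul_pow]; norm_num
    exact_mod_cast h2 ▸ h1
  calc _ ≤ graphProbability N p {G | ∃ q : κ, G ∈ {G : SimpleGraph (Fin N) |
        (G.edgeFinset ∩ F q).card ≤ s}} := by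
        refine graphProbability_mono hp0 hp1 ?_
        rintro G ⟨X, Y, hX, hY, h⟩
        obtain ⟨X', Y', h1, h2⟩ := exists_disjoint_few_edges hX hY h
        exact ⟨⟨(X', Y'), h1⟩, h2⟩
    _ ≤ ∑ q : κ, 2 ^ s * (1 - p / 2) ^ (k * k) := by
        refine (graphProbability_exists_le hp0 hp1 _).trans (Finset.sum_le_sum fun q _ => ?_)
        rw [← hFc q]
        exact graphProbability_few_edges_le hp0 hp1 (F q) (hF q) s
    _ = Fintype.card κ * (2 ^ s * (1 - p / 2) ^ (k * k)) := by simp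
    _ ≤ _ := by
        have : 0 ≤ 1 - p / 2 := by linarith
        gcongr

open Classical in
theorem exists_tendsto_graphProbability_dense_pairs {p γ : ℝ} (hp0 : 0 < p) (hp1 : p ≤ 1)
    (hγ : 0 < γ) : ∃ η : ℝ, 0 < η ∧ Filter.Tendsto (fun N : ℕ => graphProbability N p
      {G | ∀ X Y : Finset (Fin N), γ * N ≤ X.card → γ * N ≤ Y.card →
        η * N ^ 2 < ((X ×ˢ Y).filter fun x => G.Adj x.1 x.2).card}) Filter.atTop (nhds 1) := by
  obtain ⟨a, ha⟩ : ∃ a : ℝ, a = -Real.log (1 - p / 2) := ⟨_, rfl⟩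
  have hq : 0 < 1 - p / 2 := by linarith
  have ha0 : 0 < a := by rw [ha]; exact neg_pos.2 (Real.log_neg hq (by linarith))
  have hqa : 1 - p / 2 = Real.exp (-a) := by rw [ha, neg_neg, Real.exp_log hq]
  obtain ⟨η, hη⟩ : ∃ η : ℝ, η = a * γ ^ 2 / 32 := ⟨_, rfl⟩
  have hη0 : 0 < η := by rw [hη]; positivity
  refine ⟨η, hη0, ?_⟩
  have hlim : Filter.Tendsto (fun N : ℕ => 1 - Real.exp (2 * N + -η * N ^ 2)) Filter.atTop
      (nhds 1) := by
    have h1 : Filter.Tendsto (fun N : ℕ => η * (N : ℝ) ^ 2 - 2 * N) Filter.atTop Filter.atTop := by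
      have h2 : Filter.Tendsto (fun N : ℕ => (N : ℝ) * (η * N - 2)) Filter.atTop Filter.atTop := by
        refine tendsto_natCast_atTop_atTop.atTop_mul_atTop₀ ?_
        exact Filter.tendsto_atTop_add_const_right _ _
          (tendsto_natCast_atTop_atTop.const_mul_atTop hη0)
      refine h2.congr fun N => by ring
    have h3 := Real.tendsto_exp_neg_atTop_nhds_zero.comp h1
    have h4 := h3.const_sub 1
    rw [sub_zero] at h4
    refine h4.congr fun N => ?_
    simp only [Function.comp]
    congr 2; ring
  refine tendsto_of_tendsto_of_tendsto_of_le_of_le' hlim tendsto_const_nhds ?_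
    (Filter.Eventually.of_forall fun N => ?_)
  · filter_upwards [Filter.eventually_ge_atTop ⌈8 / γ⌉₊] with N hN
    have hN' : 8 / γ ≤ N := (Nat.le_ceil _).trans (by exact_mod_cast hN)
    rw [div_le_iff₀' hγ] at hN'
    obtain ⟨k, hk⟩ : ∃ k : ℕ, k = ⌊γ * N / 2⌋₊ := ⟨_, rfl⟩
    obtain ⟨s, hs⟩ : ∃ s : ℕ, s = ⌊η * (N : ℝ) ^ 2⌋₊ := ⟨_, rfl⟩
    have hk1 : (k : ℝ) ≤ γ * N / 2 := by rw [hk]; exact Nat.floor_le (by positivity)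
    have hk2 : γ * N / 4 ≤ k := by
      have := Nat.lt_floor_add_one (γ * N / 2)
      rw [← hk] at this
      linarith
    have hs1 : (s : ℝ) ≤ η * N ^ 2 := by rw [hs]; exact Nat.floor_le (by positivity)
    rw [← graphProbability_add_compl N p {G | ∀ X Y : Finset (Fin N), γ * N ≤ X.card →
      γ * N ≤ Y.card → η * N ^ 2 < ((X ×ˢ Y).filter fun x => G.Adj x.1 x.2).card}]
    have h1 := graphProbability_sparse_pair_le (N := N) hp0.le hp1 k s
    have h2 : (4 : ℝ) ^ N * (2 ^ s * (1 - p / 2) ^ (k * k)) ≤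
        Real.exp (2 * N + -η * N ^ 2) := by
      have he : (2 : ℝ) ≤ Real.exp 1 := by have := Real.add_one_le_exp (1 : ℝ); linarith
      have h4 : (4 : ℝ) ^ N ≤ Real.exp (2 * N) := by
        rw [mul_comm, Real.exp_nat_mul]
        gcongr
        calc (4 : ℝ) = 2 * 2 := by norm_num
          _ ≤ Real.exp 1 * Real.exp 1 := by gcongr
          _ = _ := by rw [← Real.exp_add]; norm_num
      have h5 : (2 : ℝ) ^ s ≤ Real.exp (η * N ^ 2) := by
        calc (2 : ℝ) ^ s ≤ Real.exp 1 ^ s := by gcongr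
          _ = Real.exp s := by rw [← Real.exp_nat_mul, mul_one]
          _ ≤ _ := Real.exp_le_exp.2 hs1
      have h6 : (1 - p / 2) ^ (k * k) ≤ Real.exp (-(2 * η) * N ^ 2) := by
        rw [hqa, ← Real.exp_nat_mul]
        refine Real.exp_le_exp.2 ?_
        have : (γ * N / 4) * (γ * N / 4) ≤ (k : ℝ) * k := by gcongr
        have := mul_le_mul_of_nonneg_left this ha0.le
        rw [hη]; push_cast; linarith
      calc _ ≤ Real.exp (2 * N) * (Real.exp (η * N ^ 2) * Real.exp (-(2 * η) * N ^ 2)) := by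
            gcongr
        _ = _ := by
            rw [← Real.exp_add, ← Real.exp_add]
            congr 1; ring
    have h3 := h1.trans h2
    have h4 : graphProbability N p {G | ∀ X Y : Finset (Fin N), γ * N ≤ X.card →
        γ * N ≤ Y.card → η * N ^ 2 < ((X ×ˢ Y).filter fun x => G.Adj x.1 x.2).card}ᶜ ≤
        graphProbability N p {G | ∃ X Y : Finset (Fin N), 2 * k ≤ X.card ∧ 2 * k ≤ Y.card ∧
          ((X ×ˢ Y).filter fun x => G.Adj x.1 x.2).card ≤ s} := by
      refine graphProbability_mono hp0.le hp1 ?_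
      intro G hG
      rw [Set.mem_compl_iff, Set.mem_ofPred_eq] at hG
      push Not at hG
      obtain ⟨X, Y, hX, hY, h⟩ := hG
      refine ⟨X, Y, ?_, ?_, ?_⟩
      · have : (2 * k : ℝ) ≤ X.card := by linarith
        exact_mod_cast this
      · have : (2 * k : ℝ) ≤ Y.card := by linarith
        exact_mod_cast this
      · rw [hs]; exact Nat.le_floor h
    linarith
  · rw [← graphProbability_univ N p]
    exact graphProbability_mono hp0.le hp1 (Set.subset_univ _)

lemma Covers.of_coarsening {V ι κ : Type*} {c : V → ι} {c' : V → κ} {t : V → ℕ} {u v : V}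
    (hc : ∀ u v, c u = c v → c' u = c' v) (h : Covers c t u v) : Covers c' t u v :=
  ⟨hc u v h.1, h.2⟩

lemma sum_sum_classWeight {V ι : Type*} [Fintype V] [Fintype ι] (c : V → ι) (t : V → ℕ) :
    ∑ x, ∑ v, classWeight c t x v = ∑ v, t v := by
  classical
  rw [Finset.sum_comm]
  refine Finset.sum_congr rfl fun v _ => ?_
  simp [classWeight]

lemma exists_ne_add_le {n : ℕ} {s : Fin (n + 2) → ℝ} {B W : ℝ} (hs : ∑ x, s x ≤ W)
    (h : 2 * W ≤ (n + 2) * B) : ∃ x y, x ≠ y ∧ s x + s y ≤ B := by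
  by_contra! hcon
  have h1 : ∑ _x : Fin (n + 2), B < ∑ x, (s x + s (finRotate (n + 2) x)) := by
    refine Finset.sum_lt_sum_of_nonempty Finset.univ_nonempty fun x _ => hcon _ _ ?_
    rw [finRotate_apply]
    intro h
    simp at h
  rw [Finset.sum_add_distrib, Equiv.sum_comp (finRotate (n + 2)) s] at h1
  simp at h1
  linarith

lemma exists_coarsening_fin {V : Type*} [Fintype V] {t : V → ℕ} {B W : ℝ} {K : ℕ} (hK : 1 ≤ K)
    (hW : ((∑ v, t v : ℕ) : ℝ) ≤ W) (hB : 0 ≤ B) (hKB : 2 * W ≤ K * B) (n : ℕ) (c : V → Fin n)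
    (hc : ∀ x, ∑ v, (classWeight c t x v : ℝ) ≤ B) :
    ∃ c' : V → Fin K, (∀ u v, c u = c v → c' u = c' v) ∧
      ∀ x, ∑ v, (classWeight c' t x v : ℝ) ≤ B := by
  classical
  induction n with
  | zero =>
    have : IsEmpty V := ⟨fun v => (c v).elim0⟩
    exact ⟨fun v => (c v).elim0, fun u => (c u).elim0, fun x => by simpa using hB⟩
  | succ n ih =>
    by_cases hn : n + 1 ≤ K
    · refine ⟨Fin.castLE hn ∘ c, fun u v h => by simp [h], fun x => ?_⟩
      by_cases hx : ∃ y, Fin.castLE hn y = x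
      · obtain ⟨y, rfl⟩ := hx
        convert hc y using 3 with v
        simp [classWeight]
      · rw [Finset.sum_eq_zero]
        · exact hB
        · intro v _
          simp only [classWeight, Function.comp]
          rw [if_neg fun h => hx ⟨c v, h⟩, Nat.cast_zero]
    obtain ⟨k, rfl⟩ : ∃ k, n = k + 1 := ⟨n - 1, by omega⟩
    obtain ⟨x, y, hxy, hle⟩ := exists_ne_add_le (n := k)
      (s := fun x => ∑ v, (classWeight c t x v : ℝ)) (B := B) (W := W) (by
        refine le_trans (le_of_eq ?_) hW
        exact_mod_cast sum_sum_classWeight c t) (by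
        refine hKB.trans ?_
        gcongr
        exact_mod_cast (by omega : K ≤ k + 2))
    let f : Fin (k + 2) → {z // z ≠ y} := fun z => if h : z = y then ⟨x, hxy⟩ else ⟨z, h⟩
    let e := (finSuccAboveEquiv y).symm
    obtain ⟨c', h1, h2⟩ := ih (e ∘ f ∘ c) (fun w => by
      obtain ⟨⟨z, hz⟩, rfl⟩ := e.surjective w
      by_cases hzx : z = x
      · subst hzx
        refine le_trans (le_of_eq ?_) hle
        rw [← Finset.sum_add_distrib]
        refine Finset.sum_congr rfl fun v _ => ?_
        simp only [classWeight, Function.comp, EmbeddingLike.apply_eq_iff_eq, f]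
        by_cases hv : c v = y
        · simp [hv, hz.symm]
        · simp [hv]
      · refine le_trans (Finset.sum_le_sum fun v _ => ?_) (hc z)
        simp only [classWeight, Function.comp, EmbeddingLike.apply_eq_iff_eq, f]
        by_cases hv : c v = y
        · simp [hv, Ne.symm hzx, hz.symm]
        · simp [hv])
    exact ⟨c', fun u v h => h1 u v (by simp [h]), h2⟩

lemma exists_coarsening {V ι : Type*} [Fintype V] {c : V → ι} {t : V → ℕ} {B W : ℝ} {K : ℕ}
    (hK : 1 ≤ K) (hW : ((∑ v, t v : ℕ) : ℝ) ≤ W) (hB : 0 ≤ B) (hKB : 2 * W ≤ K * B)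
    (hc : ∀ x, ∑ v, (classWeight c t x v : ℝ) ≤ B) :
    ∃ c' : V → Fin K, (∀ u v, c u = c v → c' u = c' v) ∧
      ∀ x, ∑ v, (classWeight c' t x v : ℝ) ≤ B := by
  classical
  let e := Fintype.equivFin (Set.range c)
  obtain ⟨c', h1, h2⟩ := exists_coarsening_fin hK hW hB hKB _ (e ∘ Set.rangeFactorization c)
    (fun x => by
      obtain ⟨⟨_, u, rfl⟩, rfl⟩ := e.surjective x
      refine le_trans (le_of_eq ?_) (hc (c u))
      refine Finset.sum_congr rfl fun v _ => ?_
      simp [classWeight, Set.rangeFactorization, Subtype.ext_iff])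
  refine ⟨c', fun u v h => h1 u v ?_, h2⟩
  simp [Set.rangeFactorization, h]

lemma exists_large_fibres {V T : Type*} [Fintype V] [Fintype T] (τ : V → T) {a : ℝ}
    (ha : 0 ≤ a) : ∃ S : Finset V,
      (∀ v ∈ S, ∃ X : Finset V, (∀ u ∈ X, τ u = τ v) ∧ a ≤ X.card) ∧
      (Fintype.card V : ℝ) ≤ S.card + Fintype.card T * a := by
  classical
  obtain ⟨S, hS⟩ : ∃ S : Finset V, S = Finset.univ.filter fun v =>
    a ≤ (Finset.univ.filter fun u => τ u = τ v).card := ⟨_, rfl⟩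
  refine ⟨S, fun v hv => ⟨Finset.univ.filter fun u => τ u = τ v,
    fun u hu => (Finset.mem_filter.1 hu).2, ?_⟩, ?_⟩
  · rw [hS] at hv
    exact (Finset.mem_filter.1 hv).2
  have h1 : (Sᶜ.card : ℝ) ≤ Fintype.card T * a := by
    rw [Finset.card_eq_sum_card_fiberwise (f := τ) (t := Finset.univ) fun _ _ => by simp]
    push_cast
    calc _ ≤ ∑ _x : T, a := by
          refine Finset.sum_le_sum fun x _ => ?_
          by_cases h : ∃ v ∈ Sᶜ, τ v = x
          · obtain ⟨v, hv, rfl⟩ := h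
            have hv' : ¬ a ≤ (Finset.univ.filter fun u => τ u = τ v).card := by
              intro h
              rw [hS] at hv
              exact Finset.mem_compl.1 hv (Finset.mem_filter.2 ⟨Finset.mem_univ _, h⟩)
            refine le_trans ?_ (not_le.1 hv').le
            exact_mod_cast Finset.card_le_card (Finset.filter_subset_filter _ (Finset.subset_univ _))
          · rw [Finset.filter_eq_empty_iff.2 fun v hv hvx => h ⟨v, hv, hvx⟩]
            simpa using ha
      _ = _ := by simp
  rw [← Finset.card_add_card_compl S]
  push_cast
  linarith

open Classical in
lemma two_mul_card_le_of_dense_pairs {N K : ℕ} {G : SimpleGraph (Fin N)}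
    {c : Fin 3 → Fin N → Fin K} {t : Fin 3 → Fin N → ℕ} (ht : ∀ i v, t i v ≤ 2) {b : Fin 3 → ℝ}
    (hb0 : ∀ i, 0 ≤ b i) (hb : ∀ i, b i ≤ b 0)
    (hcost : ∀ i x, ∑ v, (classWeight (c i) (t i) x v : ℝ) ≤ b i) {γ s : ℝ} (hγ : 0 ≤ γ)
    (huncov : ∀ E : Finset (Fin N × Fin N),
      (∀ x ∈ E, G.Adj x.1 x.2 ∧ ∀ i, ¬ Covers (c i) (t i) x.1 x.2) → (E.card : ℝ) ≤ s)
    (hdense : ∀ X Y : Finset (Fin N), γ * N ≤ X.card → γ * N ≤ Y.card →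
      s < ((X ×ˢ Y).filter fun x => G.Adj x.1 x.2).card) :
    2 * ((1 - (K * 3 : ℕ) ^ 3 * γ) * N) ≤ 2 * b 0 + b 1 + b 2 := by
  let τ : Fin N → (Fin 3 → Fin K × Fin 3) := fun v i => (c i v, ⟨t i v, by have := ht i v; omega⟩)
  obtain ⟨S, hS, h1⟩ := exists_large_fibres τ (a := γ * N) (by positivity)
  rw [Fintype.card_fin, Fintype.card_fun, Fintype.card_prod, Fintype.card_fin, Fintype.card_fin]
    at h1
  push_cast at h1 ⊢
  have hτ : ∀ {u u' : Fin N}, τ u = τ u' → ∀ i, c i u = c i u' ∧ t i u = t i u' := by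
    intro u u' h i
    have := congrFun h i
    simpa [τ] using this
  rcases S.eq_empty_or_nonempty with hne | hne
  · rw [hne] at h1
    simp only [Finset.card_empty, Nat.cast_zero] at h1
    have := hb0 0
    have := hb0 1
    have := hb0 2
    nlinarith
  have h2 := two_mul_card_le_of_covers (c₁ := c 0) (c₂ := c 1) (c₃ := c 2) (t₁ := t 0) (t₂ := t 1)
    (t₃ := t 2) (S := S) (b₁ := b 0) (b₂ := b 1) (b₃ := b 2) (M := b 0) (fun u hu v hv => by
      by_contra! hcon
      obtain ⟨X, hX, hXc⟩ := hS u hu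
      obtain ⟨Y, hY, hYc⟩ := hS v hv
      refine (hdense X Y hXc hYc).not_ge (huncov _ fun x hx => ?_)
      obtain ⟨hxy, hadj⟩ := Finset.mem_filter.1 hx
      obtain ⟨hx1, hx2⟩ := Finset.mem_product.1 hxy
      refine ⟨hadj, fun i hcov => ?_⟩
      have e1 := hτ (hX _ hx1) i
      have e2 := hτ (hY _ hx2) i
      have : Covers (c i) (t i) u v := by
        rw [Covers, ← e1.1, ← e1.2, ← e2.1, ← e2.2]; exact hcov
      fin_cases i
      · exact hcon.1 this
      · exact hcon.2.1 this
      · exact hcon.2.2 this)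
    (fun x => (Finset.sum_le_univ_sum_of_nonneg fun _ => Nat.cast_nonneg _).trans (hcost 0 x))
    (fun x => (Finset.sum_le_univ_sum_of_nonneg fun _ => Nat.cast_nonneg _).trans (hcost 1 x))
    (fun x => (Finset.sum_le_univ_sum_of_nonneg fun _ => Nat.cast_nonneg _).trans (hcost 2 x))
    le_rfl (hb 1) (hb 2) hne
  linarith

lemma hasMonoCycle_of_isCycle {V : Type*} {G : SimpleGraph V} {k : ℕ} {c : G.edgeSet → Fin k}
    {i : Fin k} {v : V} {w : (SimpleGraph.fromEdgeSet {e | ∃ h, c ⟨e, h⟩ = i}).Walk v v}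
    (hw : w.IsCycle) : HasMonoCycle G c i w.length := by
  have hle : SimpleGraph.fromEdgeSet {e | ∃ h, c ⟨e, h⟩ = i} ≤ G := by
    intro u v huv
    obtain ⟨⟨h, -⟩, -⟩ := (SimpleGraph.fromEdgeSet_adj _).1 huv
    exact h
  refine ⟨v, w.mapLe hle, hw.mapLe hle, by simp, fun e h => ?_⟩
  rw [SimpleGraph.Walk.edges_mapLe_eq_edges] at h
  have h1 := w.edges_subset_edgeSet h
  rw [SimpleGraph.edgeSet_fromEdgeSet] at h1
  exact h1.1.2

lemma card_le_of_not_covers {V ι : Type*} {G : SimpleGraph V} {col : G.edgeSet → Fin 3}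
    {c : Fin 3 → V → ι} {t : Fin 3 → V → ℕ} {a : ℝ}
    (h : ∀ i, ∀ E : Finset (V × V), (∀ x ∈ E,
      (SimpleGraph.fromEdgeSet {e | ∃ h, col ⟨e, h⟩ = i}).Adj x.1 x.2 ∧
        ¬ Covers (c i) (t i) x.1 x.2) → (E.card : ℝ) ≤ a)
    (E : Finset (V × V)) (hE : ∀ x ∈ E, G.Adj x.1 x.2 ∧ ∀ i, ¬ Covers (c i) (t i) x.1 x.2) :
    (E.card : ℝ) ≤ 3 * a := by
  classical
  have h1 : E.card ≤ ∑ i : Fin 3, (E.filter fun x => ∃ h, col ⟨s(x.1, x.2), h⟩ = i).card := by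
    refine le_trans (Finset.card_le_card fun x hx => ?_) Finset.card_biUnion_le
    exact Finset.mem_biUnion.2 ⟨col ⟨s(x.1, x.2), (hE x hx).1⟩, Finset.mem_univ _,
      Finset.mem_filter.2 ⟨hx, _, rfl⟩⟩
  have h2 : ∀ i, ((E.filter fun x => ∃ h, col ⟨s(x.1, x.2), h⟩ = i).card : ℝ) ≤ a := by
    refine fun i => h i _ fun x hx => ?_
    obtain ⟨hx1, hx2⟩ := Finset.mem_filter.1 hx
    exact ⟨(SimpleGraph.fromEdgeSet_adj _).2 ⟨hx2, (hE x hx1).1.ne⟩, (hE x hx1).2 i⟩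
  calc (E.card : ℝ) ≤ ∑ i : Fin 3, ((E.filter fun x => ∃ h, col ⟨s(x.1, x.2), h⟩ = i).card : ℝ) := by
        exact_mod_cast h1
    _ ≤ ∑ _i : Fin 3, a := Finset.sum_le_sum fun i _ => h2 i
    _ = _ := by simp

open Classical in
theorem exists_eventually_arrowsCycles {α₁ α₂ α₃ δ : ℝ} (h12 : α₂ ≤ α₁) (h23 : α₃ ≤ α₂)
    (h3 : 0 < α₃) (hδ : 0 < δ) : ∃ γ : ℝ, 0 < γ ∧ ∀ η : ℝ, 0 < η → ∀ᶠ n : ℕ in Filter.atTop,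
      ∀ N : ℕ, N = ⌈(2 * α₁ + α₂ + α₃ + δ) * (n : ℝ)⌉₊ → ∀ G : SimpleGraph (Fin N),
      (∀ X Y : Finset (Fin N), γ * N ≤ X.card → γ * N ≤ Y.card →
        η * N ^ 2 < ((X ×ˢ Y).filter fun x => G.Adj x.1 x.2).card) →
      ArrowsCycles G
        ![2 * ⌊α₁ * (n : ℝ)⌋₊, 2 * ⌊α₂ * (n : ℝ)⌋₊, 2 * ⌊α₃ * (n : ℝ)⌋₊] := by
  obtain ⟨σ, hσ⟩ : ∃ σ : ℝ, σ = 2 * α₁ + α₂ + α₃ := ⟨_, rfl⟩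
  have hσ0 : 0 < σ := by rw [hσ]; linarith
  obtain ⟨K, hK⟩ : ∃ K : ℕ, K = ⌈8 * (σ + δ) / α₃⌉₊ := ⟨_, rfl⟩
  have hKα : 8 * (σ + δ) ≤ K * α₃ := by
    rw [← div_le_iff₀ h3, hK]; exact Nat.le_ceil _
  have hK1 : 1 ≤ K := by rw [hK]; exact Nat.one_le_ceil_iff.2 (by positivity)
  obtain ⟨T, hT⟩ : ∃ T : ℝ, T = (K * 3 : ℕ) ^ 3 := ⟨_, rfl⟩
  have hT0 : 0 < T := by rw [hT]; exact pow_pos (by exact_mod_cast (by omega)) _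
  obtain ⟨γ, hγ⟩ : ∃ γ : ℝ, γ = δ / (4 * (σ + δ) * T) := ⟨_, rfl⟩
  have hγ0 : 0 < γ := by rw [hγ]; positivity
  have hTγ : (σ + δ) * (T * γ) = δ / 4 := by
    rw [hγ]; field_simp
  refine ⟨γ, hγ0, fun η hη => ?_⟩
  obtain ⟨ε, hε⟩ : ∃ ε : ℝ, ε = min (min 1 (δ / σ)) (min (η / 3) (α₃ / (4 * (σ + δ)))) := ⟨_, rfl⟩
  have hε0 : 0 < ε := by
    rw [hε]
    exact lt_min (lt_min one_pos (by positivity)) (lt_min (by positivity) (by positivity))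
  have hε1 : ε ≤ 1 := by rw [hε]; exact (min_le_left _ _).trans (min_le_left _ _)
  have hε2 : ε * σ ≤ δ := by
    rw [← le_div_iff₀ hσ0, hε]; exact (min_le_left _ _).trans (min_le_right _ _)
  have hε3 : 3 * ε ≤ η := by
    rw [← le_div_iff₀' (by norm_num), hε]; exact (min_le_right _ _).trans (min_le_left _ _)
  have hε4 : ε * (4 * (σ + δ)) ≤ α₃ := by
    rw [← le_div_iff₀ (by positivity), hε]; exact (min_le_right _ _).trans (min_le_right _ _)
  obtain ⟨N₀, hN₀⟩ := exists_cycle_or_weights hε0 hε1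
  filter_upwards [Filter.eventually_ge_atTop 1, tendsto_natCast_atTop_atTop.eventually_ge_atTop
    (N₀ / (σ + δ)), tendsto_natCast_atTop_atTop.eventually_ge_atTop (2 / α₃),
    tendsto_natCast_atTop_atTop.eventually_ge_atTop (1 / (σ + δ))] with n hn1 hn2 hn3 hn4
  intro N hN G hdense
  rw [← hσ] at hN
  have hσδ : 0 < σ + δ := by linarith
  rw [div_le_iff₀' (by assumption)] at hn2 hn3 hn4
  have hn0 : (0 : ℝ) < n := by exact_mod_cast hn1
  have hNl : (σ + δ) * n ≤ N := by rw [hN]; exact Nat.le_ceil _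
  have hNu : (N : ℝ) ≤ 2 * ((σ + δ) * n) := by
    have := Nat.ceil_lt_add_one (show 0 ≤ (σ + δ) * (n : ℝ) by positivity)
    rw [← hN] at this
    linarith
  have hNN₀ : N₀ ≤ N := by exact_mod_cast hn2.trans hNl
  obtain ⟨α, hα⟩ : ∃ α : Fin 3 → ℝ, α = ![α₁, α₂, α₃] := ⟨_, rfl⟩
  obtain ⟨m, hm⟩ : ∃ m : Fin 3 → ℕ, m = fun i => ⌊α i * (n : ℝ)⌋₊ := ⟨_, rfl⟩
  have hαi : ∀ i, α₃ ≤ α i := by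
    intro i
    fin_cases i <;> simp [hα] <;> linarith
  have hmeq : (![2 * ⌊α₁ * (n : ℝ)⌋₊, 2 * ⌊α₂ * (n : ℝ)⌋₊, 2 * ⌊α₃ * (n : ℝ)⌋₊] : Fin 3 → ℕ) =
      fun i => 2 * m i := by
    funext i
    fin_cases i <;> simp [hm, hα]
  have hml : ∀ i, α₃ * n ≤ 2 * m i := by
    intro i
    have h1 := Nat.lt_floor_add_one (α i * n)
    have h2 : (m i : ℝ) = (⌊α i * (n : ℝ)⌋₊ : ℝ) := by rw [hm]
    have h4 : α₃ * n ≤ α i * n := by gcongr; exact hαi i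
    rw [← h2] at h1
    linarith
  have hmu : ∀ i, (m i : ℝ) ≤ α i * n := by
    intro i
    rw [hm]
    exact Nat.floor_le (mul_nonneg (h3.le.trans (hαi i)) hn0.le)
  have hm0 : ∀ i, m i ≤ m 0 := by
    intro i
    rw [hm]
    refine Nat.floor_le_floor ?_
    gcongr
    fin_cases i <;> simp [hα] <;> linarith
  have hεm : ∀ i, ε * N ≤ m i := by
    intro i
    have h1 : ε * N ≤ ε * (2 * ((σ + δ) * n)) := by gcongr
    have h2 : ε * (4 * (σ + δ)) * n ≤ α₃ * n := by gcongr
    have := hml i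
    linarith
  rw [hmeq]
  intro col
  by_contra! hcon
  have key : ∀ i, ∃ (c : Fin N → Fin K) (t : Fin N → ℕ), (∀ v, t v ≤ 2) ∧
      (∀ x, ∑ v, (classWeight c t x v : ℝ) ≤ (2 + ε) * m i) ∧
      ∀ E : Finset (Fin N × Fin N), (∀ x ∈ E,
        (SimpleGraph.fromEdgeSet {e | ∃ h, col ⟨e, h⟩ = i}).Adj x.1 x.2 ∧
          ¬ Covers c t x.1 x.2) → (E.card : ℝ) ≤ ε * N ^ 2 := by
    intro i
    rcases hN₀ N hNN₀ (SimpleGraph.fromEdgeSet {e | ∃ h, col ⟨e, h⟩ = i}) (m i) (hεm i) with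
      ⟨v, w, hw, hwl⟩ | ⟨ι, c, t, ht, hcost, hE⟩
    · exact absurd (hwl ▸ hasMonoCycle_of_isCycle hw) (hcon i)
    · have h1 : ((∑ v, t v : ℕ) : ℝ) ≤ 2 * N := by
        have : ∑ v, t v ≤ ∑ _v : Fin N, 2 := Finset.sum_le_sum fun v _ => ht v
        rw [Finset.sum_const, Finset.card_univ, Fintype.card_fin, smul_eq_mul, mul_comm] at this
        exact_mod_cast this
      obtain ⟨c', hc, hcost'⟩ := exists_coarsening hK1 h1 (by positivity) (by
        have h2 : 8 * (σ + δ) * n ≤ K * α₃ * n := by gcongr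
        have h4 : (K : ℝ) * (α₃ * n) ≤ K * ((2 + ε) * m i) := by
          refine mul_le_mul_of_nonneg_left ?_ (Nat.cast_nonneg _)
          have := mul_nonneg hε0.le (Nat.cast_nonneg (α := ℝ) (m i))
          have := hml i
          linarith
        linarith) hcost
      exact ⟨c', t, ht, hcost', fun E hE' => hE E fun x hx =>
        ⟨(hE' x hx).1, fun h => (hE' x hx).2 (h.of_coarsening hc)⟩⟩
  choose c t ht hcost hE using key
  have hfin := two_mul_card_le_of_dense_pairs ht (b := fun i => (2 + ε) * m i)
    (fun i => by positivity) (fun i => by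
      have : (m i : ℝ) ≤ m 0 := by exact_mod_cast hm0 i
      gcongr) hcost hγ0.le (s := η * N ^ 2) (fun E hE' => by
      refine (card_le_of_not_covers hE E hE').trans ?_
      rw [← mul_assoc]
      gcongr) hdense
  rw [← hT] at hfin
  have e0 : (m 0 : ℝ) ≤ α₁ * n := by simpa [hα] using hmu 0
  have e1 : (m 1 : ℝ) ≤ α₂ * n := by simpa [hα] using hmu 1
  have e2 : (m 2 : ℝ) ≤ α₃ * n := by simpa [hα] using hmu 2
  have h5 : (2 + ε) * (2 * m 0 + m 1 + m 2) ≤ (2 + ε) * (σ * n) := by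
    rw [hσ]
    gcongr
    linarith
  have h6 : ε * σ * n ≤ δ * n := by gcongr
  have hTγ1 : T * γ ≤ 1 := by
    by_contra! h
    nlinarith
  have h7 : (1 - T * γ) * ((σ + δ) * n) ≤ (1 - T * γ) * N :=
    mul_le_mul_of_nonneg_left hNl (by linarith)
  have h8 : (1 - T * γ) * ((σ + δ) * n) = (σ + δ - δ / 4) * n := by
    rw [← hTγ]; ring
  have h9 : 0 < δ * n := by positivity
  linarith

theorem stmt4 (p : ℝ) (hp0 : 0 < p) (hp1 : p ≤ 1) (α₁ α₂ α₃ : ℝ)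
    (h12 : α₂ ≤ α₁) (h23 : α₃ ≤ α₂) (h3 : 0 < α₃) (δ : ℝ) (hδ : 0 < δ) :
    Filter.Tendsto (fun n : ℕ =>
        graphProbability (⌈(2 * α₁ + α₂ + α₃ + δ) * (n : ℝ)⌉₊) p
          {G | ArrowsCycles G ![2 * ⌊α₁ * (n : ℝ)⌋₊, 2 * ⌊α₂ * (n : ℝ)⌋₊, 2 * ⌊α₃ * (n : ℝ)⌋₊]})
      Filter.atTop (nhds 1) := by
  obtain ⟨γ, hγ, harrow⟩ := exists_eventually_arrowsCycles h12 h23 h3 hδ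
  obtain ⟨η, hη, hlim⟩ := exists_tendsto_graphProbability_dense_pairs hp0 hp1 hγ
  have hN : Filter.Tendsto (fun n : ℕ => ⌈(2 * α₁ + α₂ + α₃ + δ) * (n : ℝ)⌉₊) Filter.atTop
      Filter.atTop :=
    tendsto_nat_ceil_atTop.comp
      (tendsto_natCast_atTop_atTop.const_mul_atTop (by linarith))
  refine tendsto_of_tendsto_of_tendsto_of_le_of_le' (hlim.comp hN) tendsto_const_nhds ?_
    (Filter.Eventually.of_forall fun n => ?_)
  · filter_upwards [harrow η hη] with n hn
    exact graphProbability_mono hp0.le hp1 fun G hG => hn _ rfl G hG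
  · rw [← graphProbability_univ _ p]
    exact graphProbability_mono hp0.le hp1 (Set.subset_univ _)
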